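/- arXiv:1312.5305 — 3 statements merged into one kernel-verified Lean document; each statement's English description precedes it below -/
import Mathlib

section
/- Let K be a field of characteristic zero and let A = K[x₁, …, x_d] be a polynomial ring. If σ : A → A is a K-algebra automorphism and I and J are ideals of A, then the set {n ∈ ℤ : σ^n(I) ⊇ J} has the two-sided SML property. -/
/-- A set `S ⊆ ℤ` has the two-sided SML property if it is a finite union of
complete doubly infinite arithmetic progressions `{a*n + b : n ∈ ℤ}` (allowing
`a = 0`, which gives singletons), together with a finite set. -/
def TwoSidedSML (S : Set ℤ) : Prop :=
  ∃ (P : Finset (ℤ × ℤ)) (F : Set ℤ), F.Finite ∧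
    S = (⋃ q ∈ P, {k : ℤ | ∃ n : ℤ, k = q.1 * n + q.2}) ∪ F

section Hansel

open Polynomial

variable {L : Type*} [NormedField L]

theorem norm_coeff_le_of_norm_coeff_X_sub_C_mul_le [IsUltrametricDist L] {t : L} (ht : ‖t‖ ≤ 1)
    {c : ℝ} (hc : 0 ≤ c) {Q : L[X]} {k : ℕ}
    (h : ∀ j ≥ k + 1, ‖((X - C t) * Q).coeff j‖ ≤ c) : ∀ j ≥ k, ‖Q.coeff j‖ ≤ c := by
  have key : ∀ m j, k ≤ j → Q.natDegree < j + m → ‖Q.coeff j‖ ≤ c := by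
    intro m
    induction m with
    | zero =>
      intro j _ hj
      rw [coeff_eq_zero_of_natDegree_lt (by simpa using hj)]
      simpa using hc
    | succ m ih =>
      intro j hkj hj
      have h1 : Q.coeff j = ((X - C t) * Q).coeff (j + 1) + t * Q.coeff (j + 1) := by
        rw [sub_mul, coeff_sub, coeff_X_mul, coeff_C_mul]; ring
      rw [h1]
      refine (IsUltrametricDist.norm_add_le_max _ _).trans (max_le (h _ (by omega)) ?_)
      rw [norm_mul]
      have := ih (j + 1) (by omega) (by omega)
      nlinarith [norm_nonneg t, norm_nonneg (Q.coeff (j + 1))]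
  intro j hj
  exact key (Q.natDegree + 1) j hj (by omega)

/-- A polynomial with many zeros in the unit disc and small high-order coefficients
is small on the unit disc. -/
theorem norm_eval_le_of_roots [IsUltrametricDist L] {c : ℝ} (hc : 0 ≤ c) (s : Finset L)
    (hs : ∀ t ∈ s, ‖t‖ ≤ 1) (P : L[X]) (hroot : ∀ t ∈ s, P.eval t = 0)
    (hP : ∀ j ≥ s.card, ‖P.coeff j‖ ≤ c) {x : L} (hx : ‖x‖ ≤ 1) : ‖P.eval x‖ ≤ c := by
  classical
  induction s using Finset.induction_on generalizing P with
  | empty =>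
    rw [eval_eq_sum_range]
    refine IsUltrametricDist.norm_sum_le_of_forall_le_of_nonneg hc fun j _ => ?_
    rw [norm_mul, norm_pow]
    have h1 := hP j (by simp)
    have h2 : ‖x‖ ^ j ≤ 1 := pow_le_one₀ (norm_nonneg _) hx
    nlinarith [norm_nonneg (P.coeff j), pow_nonneg (norm_nonneg x) j]
  | insert t s hts ih =>
    obtain ⟨Q, rfl⟩ := dvd_iff_isRoot.2 (hroot t (by simp))
    have ht := hs t (by simp)
    rw [Finset.card_insert_of_notMem hts] at hP
    have h1 : ‖Q.eval x‖ ≤ c := by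
      refine ih (fun u hu => hs u (by simp [hu])) Q (fun u hu => ?_)
        (norm_coeff_le_of_norm_coeff_X_sub_C_mul_le ht hc hP)
      have h2 := hroot u (by simp [hu])
      rw [eval_mul, eval_sub, eval_X, eval_C] at h2
      refine (mul_eq_zero.1 h2).resolve_left (sub_ne_zero.2 ?_)
      rintro rfl
      exact hts hu
    rw [eval_mul, eval_sub, eval_X, eval_C, norm_mul]
    have h2 : ‖x - t‖ ≤ 1 := by
      rw [sub_eq_add_neg]
      exact (IsUltrametricDist.norm_add_le_max _ _).trans (max_le hx (by rwa [norm_neg]))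
    nlinarith [norm_nonneg (x - t), norm_nonneg (Q.eval x)]

theorem norm_pow_div_factorial_le {p : ℕ} [Fact p.Prime] (hp : 2 < p) [NormedAlgebra ℚ_[p] L]
    (k : ℕ) : ‖(p : L) ^ k / (k.factorial : L)‖ ≤ ((p : ℝ)⁻¹) ^ (k / 2) := by
  have h0 : ‖(p : L) ^ k / (k.factorial : L)‖
      = ‖(p : ℚ_[p]) ^ k / (k.factorial : ℚ_[p])‖ := by
    rw [← norm_algebraMap' L ((p : ℚ_[p]) ^ k / (k.factorial : ℚ_[p]))]
    simp
  have hpp : (1 : ℝ) < p := by exact_mod_cast (by omega : 1 < p)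
  have h1 : ‖(k.factorial : ℚ_[p])‖ = (p : ℝ) ^ (-(padicValNat p k.factorial : ℤ)) := by
    rw [Padic.norm_eq_zpow_neg_valuation (by exact_mod_cast k.factorial_ne_zero),
      Padic.valuation_natCast]
  have h2 : 2 * padicValNat p k.factorial ≤ k := by
    have h3 := sub_one_mul_padicValNat_factorial (p := p) k
    have h4 : 2 * padicValNat p k.factorial ≤ (p - 1) * padicValNat p k.factorial :=
      Nat.mul_le_mul_right _ (by omega)
    omega
  rw [h0, norm_div, norm_pow, Padic.norm_p, h1, inv_pow, inv_pow, ← zpow_natCast, ← zpow_natCast,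
    ← zpow_neg, ← zpow_neg, ← zpow_sub₀ (by positivity)]
  refine zpow_le_zpow_right₀ hpp.le ?_
  omega

theorem norm_natCast_le_one_of_padic {p : ℕ} [Fact p.Prime] [NormedAlgebra ℚ_[p] L] (n : ℕ) :
    ‖(n : L)‖ ≤ 1 := by
  have h := norm_algebraMap' L (n : ℚ_[p])
  rw [map_natCast] at h
  rw [h]
  simpa using Padic.norm_int_le_one (p := p) n

theorem norm_intCast_le_one_of_padic {p : ℕ} [Fact p.Prime] [NormedAlgebra ℚ_[p] L] (n : ℤ) :
    ‖(n : L)‖ ≤ 1 := by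
  have h := norm_algebraMap' L (n : ℚ_[p])
  rw [map_intCast] at h
  rw [h]
  exact Padic.norm_int_le_one (p := p) n

/-- The Mahler-type series `∑ (n choose k) p ^ k b k` with bounded coefficients vanishes
identically on `ℕ` as soon as it has infinitely many zeros. -/
theorem eq_zero_of_infinite_zeros {p : ℕ} [Fact p.Prime] (hp : 2 < p) [NormedAlgebra ℚ_[p] L]
    [IsUltrametricDist L] [CharZero L] {B : ℝ} (b : ℕ → L) (hb : ∀ k, ‖b k‖ ≤ B) (v : ℕ → L)
    (hv : ∀ n, v n = ∑ k ∈ Finset.range (n + 1), (n.choose k : L) * ((p : L) ^ k * b k))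
    (hinf : {n | v n = 0}.Infinite) (n : ℕ) : v n = 0 := by
  have hB : 0 ≤ B := (norm_nonneg _).trans (hb 0)
  have hpp : (1 : ℝ) < p := by exact_mod_cast (by omega : 1 < p)
  have hq0 : (0 : ℝ) ≤ (p : ℝ)⁻¹ := by positivity
  have hq1 : (p : ℝ)⁻¹ < 1 := inv_lt_one_of_one_lt₀ hpp
  set P : ℕ → L[X] := fun m => ∑ k ∈ Finset.range m,
    C ((p : L) ^ k / (k.factorial : L) * b k) * descPochhammer L k with hPdef
  have heval : ∀ m n, n < m → (P m).eval (n : L) = v n := by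
    intro m n hnm
    have h1 : ∀ k, (C ((p : L) ^ k / (k.factorial : L) * b k) * descPochhammer L k).eval (n : L)
        = (n.choose k : L) * ((p : L) ^ k * b k) := by
      intro k
      rw [eval_mul, eval_C, descPochhammer_eval_eq_descFactorial,
        Nat.descFactorial_eq_factorial_mul_choose]
      have : (k.factorial : L) ≠ 0 := by exact_mod_cast k.factorial_ne_zero
      push_cast
      field_simp
    rw [hPdef, hv]
    simp only [eval_finsetSum, h1]
    symm
    refine Finset.sum_subset (by intro k; simp; omega) fun k _ hk => ?_
    rw [Nat.choose_eq_zero_of_lt (by simpa using hk)]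
    simp
  have hcoeff : ∀ m j K, K ≤ j → ‖(P m).coeff j‖ ≤ B * ((p : ℝ)⁻¹) ^ (K / 2) := by
    intro m j K hKj
    rw [hPdef, finsetSum_coeff]
    refine IsUltrametricDist.norm_sum_le_of_forall_le_of_nonneg (by positivity) fun k _ => ?_
    rw [coeff_C_mul, norm_mul, norm_mul]
    rcases lt_or_ge k j with hkj | hkj
    · rw [coeff_eq_zero_of_natDegree_lt (by rwa [descPochhammer_natDegree])]
      simp only [norm_zero, mul_zero]
      positivity
    · have h1 : ‖(descPochhammer L k).coeff j‖ ≤ 1 := by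
        rw [← descPochhammer_map (Int.castRingHom L) k, coeff_map]
        exact norm_intCast_le_one_of_padic (p := p) _
      have h2 := norm_pow_div_factorial_le (L := L) hp k
      have h3 : ((p : ℝ)⁻¹) ^ (k / 2) ≤ ((p : ℝ)⁻¹) ^ (K / 2) :=
        pow_le_pow_of_le_one hq0 hq1.le (by omega)
      calc _ ≤ ((p : ℝ)⁻¹) ^ (K / 2) * B * 1 := by
            gcongr
            · exact h2.trans h3
            · exact hb k
        _ = _ := by ring
  have hbound : ∀ K : ℕ, ‖v n‖ ≤ B * ((p : ℝ)⁻¹) ^ K := by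
    intro K
    obtain ⟨s, hs, hcard⟩ := hinf.exists_subset_card_eq (2 * K)
    obtain ⟨m, hm⟩ : ∃ m, ∀ k ∈ insert n s, k < m := by
      refine ⟨(insert n s).sup id + 1, fun k hk => Nat.lt_succ_of_le ?_⟩
      exact Finset.le_sup (f := id) hk
    rw [← heval m n (hm n (by simp))]
    refine norm_eval_le_of_roots (by positivity) (s.map ⟨Nat.cast, Nat.cast_injective⟩) ?_ _ ?_ ?_
      (norm_natCast_le_one_of_padic (p := p) n)
    · intro t ht
      obtain ⟨k, _, rfl⟩ := Finset.mem_map.1 ht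
      exact norm_natCast_le_one_of_padic (p := p) k
    · intro t ht
      obtain ⟨k, hk, rfl⟩ := Finset.mem_map.1 ht
      exact (heval m k (hm k (by simp [hk]))).trans (hs hk)
    · intro j hj
      have := hcoeff m j (2 * K) (by simpa [hcard] using hj)
      simpa using this
  have hlim : Filter.Tendsto (fun K : ℕ => B * ((p : ℝ)⁻¹) ^ K) Filter.atTop (nhds (B * 0)) :=
    (tendsto_pow_atTop_nhds_zero_of_lt_one hq0 hq1).const_mul B
  have := ge_of_tendsto' hlim hbound
  rw [mul_zero] at this
  exact norm_le_zero_iff.1 this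

end Hansel

section Embedding

open Polynomial

/-- A polynomial relation with coefficients in the unit disc and leading coefficient one
has all its roots in the unit disc. -/
theorem norm_le_one_of_monic_eval_eq_zero {L : Type*} [NormedField L] [IsUltrametricDist L]
    {Q : L[X]} (hQ : Q.Monic) (hcoeff : ∀ i, ‖Q.coeff i‖ ≤ 1) {x : L} (hx : Q.eval x = 0) :
    ‖x‖ ≤ 1 := by
  by_contra! hlt
  have h1 : x ^ Q.natDegree = -∑ i ∈ Finset.range Q.natDegree, Q.coeff i * x ^ i := by
    rw [eval_eq_sum_range, Finset.sum_range_succ, hQ.coeff_natDegree, one_mul] at hx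
    linear_combination hx
  obtain ⟨n, hn⟩ : ∃ n, Q.natDegree = n + 1 := by
    refine Nat.exists_eq_succ_of_ne_zero fun h0 => ?_
    rw [h0] at h1
    simp at h1
  have h2 : ‖x ^ Q.natDegree‖ ≤ ‖x‖ ^ n := by
    rw [h1, norm_neg]
    refine IsUltrametricDist.norm_sum_le_of_forall_le_of_nonneg (by positivity) fun i hi => ?_
    rw [norm_mul, norm_pow]
    have h3 : ‖x‖ ^ i ≤ ‖x‖ ^ n :=
      pow_le_pow_right₀ hlt.le (by have := Finset.mem_range.1 hi; omega)
    have := hcoeff i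
    have h4 : 0 ≤ ‖x‖ ^ i := by positivity
    nlinarith [norm_nonneg (Q.coeff i)]
  rw [norm_pow, hn, pow_succ] at h2
  have : 0 < ‖x‖ ^ n := by positivity
  nlinarith

theorem norm_map_le_one_of_isIntegral {A B L : Type*} [CommRing A] [CommRing B] [Algebra A B]
    [NormedField L] [IsUltrametricDist L] (f : B →+* L)
    (hf : ∀ a : A, ‖f (algebraMap A B a)‖ ≤ 1) {x : B} (hx : IsIntegral A x) : ‖f x‖ ≤ 1 := by
  obtain ⟨Q, hQ, hQx⟩ := hx
  refine norm_le_one_of_monic_eval_eq_zero (hQ.map (f.comp (algebraMap A B))) (fun i => ?_) ?_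
  · rw [coeff_map]
    exact hf _
  · rw [eval_map, ← hom_eval₂, hQx, map_zero]

/-- For every nonzero `g`, the ring embeds into the closed unit disc of an algebraic closure of
some `ℚ_[p]` with `p` odd, in such a way that `g` becomes a unit of the closed unit disc. -/
def PadicEmbeddable (A : Type*) [CommRing A] : Prop :=
  ∀ g : A, g ≠ 0 → ∃ (p : ℕ) (_ : Fact p.Prime), 2 < p ∧ ∃ ι : A →+* PadicAlgCl p,
    Function.Injective ι ∧ (∀ x, ‖ι x‖ ≤ 1) ∧ ‖ι g‖ = 1

theorem padicEmbeddable_int : PadicEmbeddable ℤ := by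
  intro g hg
  obtain ⟨p, hle, hp⟩ := Nat.exists_infinite_primes (g.natAbs + 3)
  have : Fact p.Prime := ⟨hp⟩
  have hnorm : ∀ x : ℤ, ‖(x : PadicAlgCl p)‖ = ‖(x : ℤ_[p])‖ := by
    intro x
    have h := PadicAlgCl.norm_extends p (x : ℚ_[p])
    rw [PadicInt.norm_def, PadicInt.coe_intCast, ← h]
    congr 1
  refine ⟨p, ⟨hp⟩, by omega, Int.castRingHom _, Int.cast_injective, fun x => ?_, ?_⟩
  · rw [eq_intCast, hnorm]
    exact PadicInt.norm_le_one _
  · rw [eq_intCast, hnorm]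
    refine le_antisymm (PadicInt.norm_le_one _) (not_lt.1 fun h => ?_)
    rw [PadicInt.norm_int_lt_one_iff_dvd] at h
    have := Int.natAbs_le_of_dvd_ne_zero h hg
    simp at this
    omega

theorem exists_transcendental_norm_sub_lt_one {p : ℕ} [Fact p.Prime] {A : Type*} [CommRing A]
    [IsDomain A] [Countable A] (ι : A →+* PadicAlgCl p) (hι : Function.Injective ι) (a : ℤ) :
    ∃ ξ : PadicAlgCl p, ‖ξ - a‖ < 1 ∧ ∀ G : A[X], eval₂ ι ξ G = 0 → G = 0 := by
  let := ι.toAlgebra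
  have : FaithfulSMul A (PadicAlgCl p) := (faithfulSMul_iff_algebraMap_injective _ _).2 hι
  have hc : {x : ℚ_[p] | IsAlgebraic A (algebraMap ℚ_[p] (PadicAlgCl p) x)}.Countable :=
    (Algebraic.countable A (PadicAlgCl p)).preimage_of_injOn
      (algebraMap ℚ_[p] (PadicAlgCl p)).injective.injOn
  have hd := hc.dense_compl ℚ_[p]
  obtain ⟨ξ, hξ, hξ'⟩ := hd.exists_mem_open (Metric.isOpen_ball (x := (a : ℚ_[p])) (ε := 1))
    ⟨a, Metric.mem_ball_self one_pos⟩
  refine ⟨algebraMap ℚ_[p] (PadicAlgCl p) ξ, ?_, fun G hG => ?_⟩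
  · have h := PadicAlgCl.norm_extends p (ξ - a)
    rw [Metric.mem_ball, dist_eq_norm] at hξ'
    have h2 : algebraMap ℚ_[p] (PadicAlgCl p) ξ - a
        = algebraMap ℚ_[p] (PadicAlgCl p) (ξ - a) := by simp
    rw [h2]
    exact h.trans_lt hξ'
  · by_contra hne
    exact hξ ⟨G, hne, hG⟩

theorem PadicEmbeddable.of_transcendental {A B : Type*} [CommRing A] [IsDomain A] [CommRing B]
    [Algebra A B] [Countable A] [CharZero A] (hA : PadicEmbeddable A) (b : B)
    (hb : Function.Surjective (aeval b : A[X] →ₐ[A] B)) (htr : Transcendental A b) :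
    PadicEmbeddable B := by
  intro g hg
  let e : A[X] ≃ₐ[A] B := AlgEquiv.ofBijective (aeval b) ⟨transcendental_iff_injective.1 htr, hb⟩
  obtain ⟨a, ha⟩ : ∃ a : ℤ, (e.symm g).eval (a : A) ≠ 0 := by
    by_contra! h
    have h0 : e.symm g = 0 := by
      refine eq_zero_of_infinite_isRoot _ ((Set.infinite_range_of_injective
        (Int.cast_injective (α := A))).mono ?_)
      rintro _ ⟨a, rfl⟩
      exact h a
    exact hg (by simpa using h0)
  obtain ⟨p, hp, hp2, ι, hι, hι1, hιg⟩ := hA _ ha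
  obtain ⟨ξ, hξa, hξ⟩ := exists_transcendental_norm_sub_lt_one ι hι a
  have hξ1 : ‖ξ‖ ≤ 1 := by
    have h1 : ‖(a : PadicAlgCl p)‖ ≤ 1 := by simpa using hι1 a
    have h2 := IsUltrametricDist.norm_add_le_max (ξ - a) (a : PadicAlgCl p)
    rw [sub_add_cancel] at h2
    exact h2.trans (max_le hξa.le h1)
  have heval : ∀ G : A[X], ‖eval₂ ι ξ G‖ ≤ 1 := by
    intro G
    rw [eval₂_eq_sum_range]
    refine IsUltrametricDist.norm_sum_le_of_forall_le_of_nonneg zero_le_one fun i _ => ?_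
    rw [norm_mul, norm_pow]
    exact mul_le_one₀ (hι1 _) (by positivity) (pow_le_one₀ (norm_nonneg _) hξ1)
  refine ⟨p, hp, hp2, (eval₂RingHom ι ξ).comp (e.symm : B →+* A[X]), ?_, fun x => heval _, ?_⟩
  · rw [injective_iff_map_eq_zero]
    intro x hx
    have := hξ (e.symm x) hx
    simpa using this
  · change ‖eval₂ ι ξ (e.symm g)‖ = 1
    obtain ⟨q, hq⟩ := X_sub_C_dvd_sub_C_eval (a := (a : A)) (p := e.symm g)
    have h1 : eval₂ ι ξ (e.symm g) = (ξ - a) * eval₂ ι ξ q + ι ((e.symm g).eval (a : A)) := by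
      have := congrArg (eval₂ ι ξ) hq
      simp only [eval₂_sub, eval₂_mul, eval₂_X, eval₂_C] at this
      rw [map_intCast ι] at this
      linear_combination this
    have h2 : ‖(ξ - a) * eval₂ ι ξ q‖ < 1 := by
      rw [norm_mul]
      exact (mul_le_of_le_one_right (norm_nonneg _) (heval q)).trans_lt hξa
    rw [h1, IsUltrametricDist.norm_add_eq_max_of_norm_ne_norm (by rw [hιg]; exact h2.ne), hιg,
      max_eq_right h2.le]

theorem PadicEmbeddable.of_algebraic {A B : Type*} [CommRing A] [IsDomain A] [CommRing B]
    [IsDomain B] [Algebra A B] [FaithfulSMul A B] (hA : PadicEmbeddable A) (b : B)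
    (hb : Function.Surjective (aeval b : A[X] →ₐ[A] B)) (halg : IsAlgebraic A b) :
    PadicEmbeddable B := by
  intro g hg
  have htop : Algebra.adjoin A {b} = ⊤ := by
    rw [Algebra.adjoin_singleton_eq_range_aeval]
    exact (AlgHom.range_eq_top _).2 hb
  have : Algebra.IsAlgebraic A B := by
    have h := Algebra.isAlgebraic_adjoin_singleton_iff.2 halg
    rw [htop] at h
    exact ⟨fun x => h x trivial⟩
  obtain ⟨h, hh, hint⟩ := halg.exists_integral_multiple
  obtain ⟨g', hg', q, hq⟩ := (Algebra.IsAlgebraic.isAlgebraic (R := A) g).exists_nonzero_dvd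
    (mem_nonZeroDivisors_of_ne_zero hg)
  obtain ⟨p, hp, hp2, ι, hι, hι1, hιg⟩ := hA (h * g') (mul_ne_zero hh hg')
  have hnorm : ‖ι h‖ = 1 ∧ ‖ι g'‖ = 1 := by
    rw [map_mul, norm_mul] at hιg
    have h1 := hι1 h
    have h2 := hι1 g'
    have h3 := norm_nonneg (ι h)
    have h4 := norm_nonneg (ι g')
    constructor <;> nlinarith
  let := ι.toAlgebra
  have : FaithfulSMul A (PadicAlgCl p) := (faithfulSMul_iff_algebraMap_injective _ _).2 hι
  let φ : B →ₐ[A] PadicAlgCl p := IsAlgClosed.lift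
  have hφ : ∀ a, φ (algebraMap A B a) = ι a := fun a => φ.commutes a
  have hφb : ‖φ b‖ ≤ 1 := by
    have h1 : ‖φ (h • b)‖ ≤ 1 :=
      norm_map_le_one_of_isIntegral (A := A) (φ : B →+* PadicAlgCl p)
        (fun a => by simpa [hφ] using hι1 a) hint
    rw [Algebra.smul_def, map_mul, norm_mul, hφ, hnorm.1, one_mul] at h1
    exact h1
  have hφ1 : ∀ x, ‖φ x‖ ≤ 1 := by
    intro x
    obtain ⟨G, rfl⟩ := hb x
    rw [aeval_eq_sum_range, map_sum]
    refine IsUltrametricDist.norm_sum_le_of_forall_le_of_nonneg zero_le_one fun i _ => ?_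
    rw [Algebra.smul_def, map_mul, map_pow, norm_mul, norm_pow, hφ]
    exact mul_le_one₀ (hι1 _) (by positivity) (pow_le_one₀ (norm_nonneg _) hφb)
  refine ⟨p, hp, hp2, φ, ?_, hφ1, ?_⟩
  · rw [injective_iff_map_eq_zero]
    intro x hx
    by_contra hx0
    obtain ⟨x', hx', y, hy⟩ := (Algebra.IsAlgebraic.isAlgebraic (R := A) x).exists_nonzero_dvd
      (mem_nonZeroDivisors_of_ne_zero hx0)
    have h1 : ι x' = 0 := by
      rw [← hφ, hy, map_mul]
      change φ x = 0 at hx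
      rw [hx, zero_mul]
    exact hx' ((injective_iff_map_eq_zero ι).1 hι _ h1)
  · have h1 : ‖φ g‖ * ‖φ q‖ = 1 := by
      rw [← norm_mul, ← map_mul, ← hq, hφ, hnorm.2]
    change ‖φ g‖ = 1
    have h2 := hφ1 g
    have h3 := hφ1 q
    have h4 := norm_nonneg (φ g)
    have h5 := norm_nonneg (φ q)
    nlinarith

theorem PadicEmbeddable.of_ringEquiv {A B : Type*} [CommRing A] [CommRing B]
    (hA : PadicEmbeddable A) (e : A ≃+* B) : PadicEmbeddable B := by
  intro g hg
  obtain ⟨p, hp, hp2, ι, hι, hι1, hιg⟩ := hA (e.symm g) (by simpa using hg)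
  exact ⟨p, hp, hp2, ι.comp (e.symm : B →+* A), hι.comp e.symm.injective, fun x => hι1 _, hιg⟩

theorem padicEmbeddable_adjoin {K : Type*} [Field K] [CharZero K] (s : Finset K) :
    PadicEmbeddable (Algebra.adjoin ℤ (s : Set K)) ∧
      Countable (Algebra.adjoin ℤ (s : Set K)) := by
  classical
  induction s using Finset.induction_on with
  | empty =>
    have e : ℤ ≃+* (⊥ : Subalgebra ℤ K) :=
      (Algebra.botEquivOfInjective (R := ℤ) (A := K) Int.cast_injective).symm.toRingEquiv
    rw [Finset.coe_empty, Algebra.adjoin_empty]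
    exact ⟨padicEmbeddable_int.of_ringEquiv e, e.symm.injective.countable⟩
  | insert b s _ ih =>
    obtain ⟨ih, hcount⟩ := ih
    set A := Algebra.adjoin ℤ (s : Set K) with hA
    have h1 : Algebra.adjoin ℤ ((insert b s : Finset K) : Set K)
        = (Algebra.adjoin A {b}).restrictScalars ℤ := by
      rw [← Algebra.adjoin_union_eq_adjoin_adjoin, Finset.coe_insert, Set.union_singleton]
    have hmem : b ∈ Algebra.adjoin A {b} := Algebra.subset_adjoin rfl
    have hsurj : Function.Surjective
        (aeval (⟨b, hmem⟩ : Algebra.adjoin A {b}) : A[X] →ₐ[A] Algebra.adjoin A {b}) := by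
      rintro ⟨x, hx⟩
      obtain ⟨G, hG⟩ := (Algebra.adjoin_singleton_eq_range_aeval A b ▸ hx : x ∈ (aeval b).range)
      refine ⟨G, Subtype.ext ?_⟩
      have h3 := aeval_algHom_apply (Algebra.adjoin A {b}).val ⟨b, hmem⟩ G
      exact h3.symm.trans hG
    have : FaithfulSMul A (Algebra.adjoin A {b}) :=
      (faithfulSMul_iff_algebraMap_injective _ _).2 fun x y h =>
        Subtype.ext (congrArg (fun z : Algebra.adjoin A {b} => (z : K)) h)
    have : Countable A[X] := by
      rw [← Cardinal.mk_le_aleph0_iff]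
      exact cardinalMk_le_max.trans (max_le (Cardinal.mk_le_aleph0_iff.2 hcount) le_rfl)
    have h2 : PadicEmbeddable (Algebra.adjoin A {b}) := by
      by_cases halg : IsAlgebraic A (⟨b, hmem⟩ : Algebra.adjoin A {b})
      · exact ih.of_algebraic _ hsurj halg
      · exact ih.of_transcendental _ hsurj halg
    rw [h1]
    exact ⟨h2, hsurj.countable⟩

end Embedding

section Local

open MvPolynomial

variable {R O : Type*} [CommRing R] [CommRing O] {d : ℕ}

/-- Change coefficients along `ι` and substitute `π * X i` for `X i`. -/
noncomputable def scaleHom (ι : R →+* O) (π : O) :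
    MvPolynomial (Fin d) R →+* MvPolynomial (Fin d) O :=
  eval₂Hom (C.comp ι) fun i => C π * X i

theorem scaleHom_C (ι : R →+* O) (π : O) (r : R) :
    scaleHom (d := d) ι π (C r) = C (ι r) := by
  simp [scaleHom]

theorem scaleHom_X (ι : R →+* O) (π : O) (i : Fin d) : scaleHom ι π (X i) = C π * X i := by
  simp [scaleHom]

theorem scaleHom_monomial (ι : R →+* O) (π : O) (α : Fin d →₀ ℕ) (r : R) :
    scaleHom ι π (monomial α r) = monomial α (π ^ α.degree * ι r) := by
  rw [scaleHom, coe_eval₂Hom, eval₂_monomial, Finsupp.prod_fintype _ _ (by simp)]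
  simp only [mul_pow, Finset.prod_mul_distrib, ← map_pow]
  rw [Finsupp.degree_eq_sum, monomial_eq, Finsupp.prod_fintype _ _ (by simp), RingHom.comp_apply,
    map_mul, ← map_prod, Finset.prod_pow_eq_pow_sum]
  ring

theorem coeff_scaleHom (ι : R →+* O) (π : O) (α : Fin d →₀ ℕ) (f : MvPolynomial (Fin d) R) :
    coeff α (scaleHom ι π f) = π ^ α.degree * ι (coeff α f) := by
  classical
  induction f using MvPolynomial.induction_on' with
  | monomial β r =>
    rw [scaleHom_monomial, coeff_monomial, coeff_monomial]
    split_ifs with h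
    · rw [h]
    · simp
  | add f g hf hg => rw [map_add, coeff_add, hf, hg, coeff_add, map_add, mul_add]

theorem C_sq_dvd_scaleHom_sub (ι : R →+* O) (π : O) {f g : MvPolynomial (Fin d) R}
    (h0 : π ^ 2 ∣ ι (coeff 0 f) - ι (coeff 0 g))
    (h1 : ∀ i, π ^ 2 ∣ ι (coeff (Finsupp.single i 1) f) - ι (coeff (Finsupp.single i 1) g)) :
    C (π ^ 2) ∣ scaleHom ι π f - scaleHom ι π g := by
  rw [C_dvd_iff_dvd_coeff]
  intro α
  rw [coeff_sub, coeff_scaleHom, coeff_scaleHom, ← mul_sub]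
  rcases Nat.lt_or_ge α.degree 2 with h | h
  · refine Dvd.dvd.mul_left ?_ _
    interval_cases hα : α.degree
    · rwa [(Finsupp.degree_eq_zero_iff α).1 hα]
    · obtain ⟨i, rfl⟩ : α ∈ Set.range fun i : Fin d => Finsupp.single i 1 := by
        rw [Finsupp.range_single_one]
        exact hα
      exact h1 i
  · exact Dvd.dvd.mul_right (pow_dvd_pow _ h) _

/-- Some positive iterate of an automorphism fixes the first order jet at the origin modulo
`π ^ 2`, provided that the residue ring modulo `π ^ 2` is finite. -/
theorem exists_pow_C_sq_dvd_scaleHom_sub (ι : R →+* O) (π : O)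
    [Finite (O ⧸ Ideal.span {π ^ 2})]
    (θ : MvPolynomial (Fin d) R ≃ₐ[R] MvPolynomial (Fin d) R) :
    ∃ M : ℕ, 0 < M ∧ ∀ f, C (π ^ 2) ∣ scaleHom ι π ((θ ^ M) f) - scaleHom ι π f := by
  let q := Ideal.Quotient.mk (Ideal.span {π ^ 2})
  let D : ℕ → Fin d → (O ⧸ Ideal.span {π ^ 2}) × (Fin d → O ⧸ Ideal.span {π ^ 2}) :=
    fun n i => (q (ι (coeff 0 ((θ ^ n) (X i)))),
      fun j => q (ι (coeff (Finsupp.single j 1) ((θ ^ n) (X i)))))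
  obtain ⟨m, n, hmn, hD⟩ : ∃ m n, m < n ∧ D n = D m := by
    obtain ⟨m, n, hne, h⟩ := Finite.exists_ne_map_eq_of_infinite D
    rcases lt_or_gt_of_ne hne with h' | h'
    · exact ⟨m, n, h', h.symm⟩
    · exact ⟨n, m, h', h⟩
  let Q := Ideal.Quotient.mk (Ideal.span {(C (π ^ 2) : MvPolynomial (Fin d) O)})
  have hq : ∀ x y, q x = q y → π ^ 2 ∣ x - y := fun x y h => by
    rwa [Ideal.Quotient.eq, Ideal.mem_span_singleton] at h
  have hQ : ∀ x y, Q x = Q y ↔ C (π ^ 2) ∣ x - y := fun x y => by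
    rw [Ideal.Quotient.eq, Ideal.mem_span_singleton]
  have hcomp : (Q.comp (scaleHom ι π)).comp
        ((θ ^ n : MvPolynomial (Fin d) R ≃ₐ[R] MvPolynomial (Fin d) R) :
          MvPolynomial (Fin d) R →+* MvPolynomial (Fin d) R)
      = (Q.comp (scaleHom ι π)).comp
        ((θ ^ m : MvPolynomial (Fin d) R ≃ₐ[R] MvPolynomial (Fin d) R) :
          MvPolynomial (Fin d) R →+* MvPolynomial (Fin d) R) := by
    refine MvPolynomial.ringHom_ext (fun r => ?_) fun i => ?_
    · have h1 : ∀ k : ℕ, (θ ^ k) (C r) = C r := fun k => (θ ^ k).commutes r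
      change Q (scaleHom ι π ((θ ^ n) (C r))) = Q (scaleHom ι π ((θ ^ m) (C r)))
      rw [h1, h1]
    · have h1 := congrFun hD i
      refine (hQ _ _).2 (C_sq_dvd_scaleHom_sub ι π ?_ fun j => ?_)
      · exact hq _ _ (congrArg Prod.fst h1)
      · exact hq _ _ (congrFun (congrArg Prod.snd h1) j)
  refine ⟨n - m, by omega, fun f => (hQ _ _).1 ?_⟩
  have h2 := congrArg (fun φ => φ ((θ ^ m).symm f)) hcomp
  have h3 : (θ ^ n) ((θ ^ m).symm f) = (θ ^ (n - m)) f := by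
    conv_lhs => rw [show n = n - m + m by omega, pow_add, AlgEquiv.mul_apply,
      AlgEquiv.apply_symm_apply]
  change Q (scaleHom ι π ((θ ^ n) ((θ ^ m).symm f)))
    = Q (scaleHom ι π ((θ ^ m) ((θ ^ m).symm f))) at h2
  rwa [h3, AlgEquiv.apply_symm_apply] at h2

theorem exists_scaleHom_pow_eq_sum (ι : R →+* O) (π : O)
    (τ : MvPolynomial (Fin d) R ≃ₐ[R] MvPolynomial (Fin d) R)
    (hτ : ∀ f, C (π ^ 2) ∣ scaleHom ι π (τ f) - scaleHom ι π f) (g : MvPolynomial (Fin d) R) :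
    ∃ b : ℕ → MvPolynomial (Fin d) O, ∀ n : ℕ, scaleHom ι π ((τ ^ n) g)
      = ∑ k ∈ Finset.range (n + 1), (n.choose k : MvPolynomial (Fin d) O) * (C (π ^ k) * b k) := by
  choose h hh using fun i => hτ (X i)
  let τ' : MvPolynomial (Fin d) O →ₐ[O] MvPolynomial (Fin d) O :=
    aeval fun i => X i + C π * h i
  have hcomm : ∀ f, scaleHom ι π (τ f) = τ' (scaleHom ι π f) := by
    have : (scaleHom ι π).comp (τ : MvPolynomial (Fin d) R →+* MvPolynomial (Fin d) R)
        = (τ' : MvPolynomial (Fin d) O →+* MvPolynomial (Fin d) O).comp (scaleHom ι π) := by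
      refine MvPolynomial.ringHom_ext (fun r => ?_) fun i => ?_
      · have h1 : τ (C r) = C r := τ.commutes r
        have h2 : τ' (C (ι r)) = C (ι r) := τ'.commutes _
        simp [h1, scaleHom_C, h2]
      · have h1 := hh i
        have h2 : τ' (C π) = C π := τ'.commutes _
        have h3 : τ' (X i) = X i + C π * h i := aeval_X _ _
        simp only [RingHom.comp_apply, RingHom.coe_coe, scaleHom_X, map_mul, h2, h3] at h1 ⊢
        rw [map_pow] at h1
        linear_combination h1
    exact fun f => congrArg (fun φ => φ f) this
  have hpow : ∀ n : ℕ, scaleHom ι π ((τ ^ n) g) = (τ'.toLinearMap ^ n) (scaleHom ι π g) := by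
    intro n
    induction n with
    | zero => simp
    | succ n ih => rw [pow_succ', pow_succ', AlgEquiv.mul_apply, hcomm, ih]; rfl
  have hdvd : ∀ f, ∃ u, (τ'.toLinearMap - 1) f = C π * u := by
    let Q := Ideal.Quotient.mk (Ideal.span {(C π : MvPolynomial (Fin d) O)})
    have : Q.comp (τ' : MvPolynomial (Fin d) O →+* MvPolynomial (Fin d) O) = Q := by
      refine MvPolynomial.ringHom_ext (fun r => ?_) fun i => ?_
      · exact congrArg Q (τ'.commutes r)
      · refine Ideal.Quotient.eq.2 (Ideal.mem_span_singleton.2 ⟨h i, ?_⟩)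
        have h3 : τ' (X i) = X i + C π * h i := aeval_X _ _
        simp [h3]
    intro f
    have h1 := congrArg (fun φ => φ f) this
    exact Ideal.mem_span_singleton.1 (Ideal.Quotient.eq.1 h1)
  have hiter : ∀ k f, ∃ u, ((τ'.toLinearMap - 1) ^ k) f = C (π ^ k) * u := by
    intro k f
    induction k with
    | zero => exact ⟨f, by simp⟩
    | succ k ih =>
      obtain ⟨u, hu⟩ := ih
      obtain ⟨w, hw⟩ := hdvd u
      refine ⟨w, ?_⟩
      rw [pow_succ', Module.End.mul_apply, hu, ← smul_eq_C_mul, map_smul, hw, smul_eq_C_mul,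
        pow_succ, map_mul, mul_assoc]
  choose b hb using fun k => hiter k (scaleHom ι π g)
  refine ⟨b, fun n => ?_⟩
  rw [hpow, show τ'.toLinearMap ^ n = ((τ'.toLinearMap - 1) + 1) ^ n by rw [sub_add_cancel],
    (Commute.one_right _).add_pow, LinearMap.sum_apply]
  refine Finset.sum_congr rfl fun k _ => ?_
  rw [one_pow, mul_one, ← nsmul_eq_mul', LinearMap.smul_apply, hb, nsmul_eq_mul]

theorem finite_quotient_span_pow {p : ℕ} [Fact p.Prime] [Algebra ℤ_[p] O] [Module.Finite ℤ_[p] O]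
    (m : ℕ) : Finite (O ⧸ Ideal.span {(p : O) ^ m}) := by
  obtain ⟨n, e, he⟩ := Module.Finite.exists_fin (R := ℤ_[p]) (M := O)
  let F : (Fin n → Fin (p ^ m)) → O ⧸ Ideal.span {(p : O) ^ m} :=
    fun c => Ideal.Quotient.mk _ (∑ i, ((c i : ℕ) : O) * e i)
  refine Finite.of_surjective F fun y => ?_
  obtain ⟨x, rfl⟩ := Ideal.Quotient.mk_surjective y
  obtain ⟨z, rfl⟩ := (Submodule.mem_span_range_iff_exists_fun ℤ_[p]).1
    (he ▸ Submodule.mem_top : x ∈ Submodule.span ℤ_[p] (Set.range e))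
  refine ⟨fun i => ⟨(z i).appr m, PadicInt.appr_lt _ _⟩, ?_⟩
  refine Ideal.Quotient.eq.2 ?_
  rw [← Finset.sum_sub_distrib]
  refine Ideal.sum_mem _ fun i _ => ?_
  obtain ⟨w, hw⟩ := Ideal.mem_span_singleton.1 (PadicInt.appr_spec m (z i))
  refine Ideal.mem_span_singleton.2 ⟨-(w • e i), ?_⟩
  have h1 := congrArg (fun t => t • e i) hw
  simp only [Algebra.smul_def, map_sub, map_mul, map_pow, map_natCast] at h1 ⊢
  linear_combination -h1

end Local

section Interpolation

open MvPolynomial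

theorem isIntegral_of_norm_le_one {p : ℕ} [Fact p.Prime] {y : PadicAlgCl p} (hy : ‖y‖ ≤ 1) :
    IsIntegral ℤ_[p] y := by
  have hint : IsIntegral ℚ_[p] y := Algebra.IsIntegral.isIntegral y
  have hmonic := minpoly.monic hint
  have hcoeff := (spectralValue_le_one_iff hmonic).1 hy
  have hlift : minpoly ℚ_[p] y ∈ Polynomial.lifts (algebraMap ℤ_[p] ℚ_[p]) := by
    rw [Polynomial.lifts_iff_coeff_lifts]
    exact fun n => ⟨⟨_, hcoeff n⟩, rfl⟩
  obtain ⟨Q, hQ, -, hQm⟩ := Polynomial.lifts_and_natDegree_eq_and_monic hlift hmonic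
  refine ⟨Q, hQm, ?_⟩
  rw [IsScalarTower.algebraMap_eq ℤ_[p] ℚ_[p] (PadicAlgCl p), ← Polynomial.eval₂_map, hQ]
  exact minpoly.aeval _ _

theorem norm_le_one_of_mem_adjoin {p : ℕ} [Fact p.Prime] {T : Set (PadicAlgCl p)}
    (hT : ∀ x ∈ T, ‖x‖ ≤ 1) {x : PadicAlgCl p} (hx : x ∈ Algebra.adjoin ℤ_[p] T) : ‖x‖ ≤ 1 := by
  induction hx using Algebra.adjoin_induction with
  | mem x hx => exact hT x hx
  | algebraMap r =>
    rw [IsScalarTower.algebraMap_apply ℤ_[p] ℚ_[p] (PadicAlgCl p)]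
    exact (PadicAlgCl.norm_extends p _).trans_le r.2
  | add x y _ _ hx hy => exact (IsUltrametricDist.norm_add_le_max _ _).trans (max_le hx hy)
  | mul x y _ _ hx hy =>
    rw [norm_mul]
    exact mul_le_one₀ hx (norm_nonneg _) hy

theorem eq_univ_of_infinite_of_forall {E : Set ℤ} (hE : E.Infinite)
    (h1 : ∀ n₀ : ℤ, {n : ℕ | n₀ + n ∈ E}.Infinite → n₀ ∈ E)
    (h2 : ∀ n₀ : ℤ, {n : ℕ | n₀ - n ∈ E}.Infinite → n₀ ∈ E) (n₀ : ℤ) : n₀ ∈ E := by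
  by_contra hn
  have f1 := Set.not_infinite.1 (mt (h1 n₀) hn)
  have f2 := Set.not_infinite.1 (mt (h2 n₀) hn)
  refine hE (((f1.image fun n : ℕ => n₀ + n).union (f2.image fun n : ℕ => n₀ - n)).subset ?_)
  intro m hm
  rcases le_total n₀ m with h | h
  · refine Or.inl ⟨(m - n₀).toNat, ?_, ?_⟩
    · have : n₀ + ((m - n₀).toNat : ℤ) = m := by omega
      change n₀ + ((m - n₀).toNat : ℤ) ∈ E
      rwa [this]
    · simp only
      omega
  · refine Or.inr ⟨(n₀ - m).toNat, ?_, ?_⟩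
    · have : n₀ - ((n₀ - m).toNat : ℤ) = m := by omega
      change n₀ - ((n₀ - m).toNat : ℤ) ∈ E
      rwa [this]
    · simp only
      omega

/-- The value at `f` of the functional with coefficient vector `c` supported on `S`. -/
noncomputable def coeffFunctional {d : ℕ} {R L : Type*} [CommRing R] [CommRing L] (ι : R →+* L)
    (S : Finset (Fin d →₀ ℕ)) (c : (Fin d →₀ ℕ) → L) (f : MvPolynomial (Fin d) R) : L :=
  ∑ α ∈ S, c α * ι (coeff α f)

theorem coeffFunctional_pow_eq_zero {d p : ℕ} [Fact p.Prime] (hp : 2 < p) {R : Type*} [CommRing R]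
    (O : Subalgebra ℤ_[p] (PadicAlgCl p)) (hO : ∀ x ∈ O, ‖x‖ ≤ 1) (ι : R →+* O)
    (S : Finset (Fin d →₀ ℕ)) (c : (Fin d →₀ ℕ) → PadicAlgCl p)
    (τ : MvPolynomial (Fin d) R ≃ₐ[R] MvPolynomial (Fin d) R)
    (hτ : ∀ f, C ((p : O) ^ 2) ∣ scaleHom ι (p : O) (τ f) - scaleHom ι (p : O) f)
    (g : MvPolynomial (Fin d) R)
    (hinf : {n : ℕ | coeffFunctional (O.val.toRingHom.comp ι) S c ((τ ^ n) g) = 0}.Infinite)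
    (n : ℕ) : coeffFunctional (O.val.toRingHom.comp ι) S c ((τ ^ n) g) = 0 := by
  have hp0 : (p : PadicAlgCl p) ≠ 0 := by exact_mod_cast (Fact.out : p.Prime).ne_zero
  obtain ⟨b, hb⟩ := exists_scaleHom_pow_eq_sum ι (p : O) τ hτ g
  let Φ : MvPolynomial (Fin d) O → PadicAlgCl p :=
    fun h => ∑ α ∈ S, c α / (p : PadicAlgCl p) ^ α.degree * (coeff α h : O)
  have hΦ : ∀ f, coeffFunctional (O.val.toRingHom.comp ι) S c f = Φ (scaleHom ι (p : O) f) := by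
    intro f
    refine Finset.sum_congr rfl fun α _ => ?_
    rw [coeff_scaleHom]
    push_cast
    rw [div_mul_eq_mul_div, mul_left_comm, mul_div_cancel_left₀ _ (pow_ne_zero _ hp0)]
    rfl
  have hΦb : ∀ h, ‖Φ h‖ ≤ ∑ α ∈ S, ‖c α / (p : PadicAlgCl p) ^ α.degree‖ := by
    intro h
    refine (norm_sum_le _ _).trans (Finset.sum_le_sum fun α _ => ?_)
    rw [norm_mul]
    exact mul_le_of_le_one_right (norm_nonneg _) (hO _ (coeff α h).2)
  refine eq_zero_of_infinite_zeros hp (fun k => Φ (b k)) (fun k => hΦb _)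
    (fun n => coeffFunctional (O.val.toRingHom.comp ι) S c ((τ ^ n) g)) (fun n => ?_) hinf n
  rw [hΦ, hb]
  simp only [Φ, coeff_sum, Finset.mul_sum]
  push_cast
  simp only [Finset.mul_sum]
  rw [Finset.sum_comm]
  refine Finset.sum_congr rfl fun k _ => Finset.sum_congr rfl fun α _ => ?_
  rw [← C_eq_coe_nat, coeff_C_mul, coeff_C_mul]
  push_cast
  ring

theorem exists_period_coeffFunctional {K : Type*} [Field K] [CharZero K] {d : ℕ} (s : Finset K)
    (θ : MvPolynomial (Fin d) (Algebra.adjoin ℤ (s : Set K)) ≃ₐ[Algebra.adjoin ℤ (s : Set K)]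
      MvPolynomial (Fin d) (Algebra.adjoin ℤ (s : Set K))) :
    ∃ (p : ℕ) (_ : Fact p.Prime) (ι : Algebra.adjoin ℤ (s : Set K) →+* PadicAlgCl p),
      Function.Injective ι ∧ ∃ M : ℕ, 0 < M ∧ ∀ S c g,
        {n : ℤ | coeffFunctional ι S c (((θ ^ M) ^ n) g) = 0}.Infinite →
          ∀ n : ℤ, coeffFunctional ι S c (((θ ^ M) ^ n) g) = 0 := by
  classical
  obtain ⟨p, hp, hp2, ι, hι, hι1, -⟩ := (padicEmbeddable_adjoin s).1 1 one_ne_zero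
  let T : Set (PadicAlgCl p) := Set.range fun x : s => ι ⟨x, Algebra.subset_adjoin x.2⟩
  let O := Algebra.adjoin ℤ_[p] T
  have hT : ∀ x ∈ T, ‖x‖ ≤ 1 := by
    rintro _ ⟨x, rfl⟩
    exact hι1 _
  have hO : ∀ x ∈ O, ‖x‖ ≤ 1 := fun x hx => norm_le_one_of_mem_adjoin hT hx
  have hfin : Module.Finite ℤ_[p] O := Module.Finite.iff_fg.2
    (fg_adjoin_of_finite (Set.finite_range _) fun x hx => isIntegral_of_norm_le_one (hT x hx))
  have hmem : ∀ r, ι r ∈ O := by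
    rintro ⟨x, hx⟩
    induction hx using Algebra.adjoin_induction with
    | mem x hx => exact Algebra.subset_adjoin ⟨⟨x, hx⟩, rfl⟩
    | algebraMap r =>
      have : ι (algebraMap ℤ _ r) ∈ O := by simp
      exact this
    | add x y hx hy h1 h2 =>
      have := add_mem h1 h2
      rwa [← map_add] at this
    | mul x y hx hy h1 h2 =>
      have := mul_mem h1 h2
      rwa [← map_mul] at this
  let ι' : Algebra.adjoin ℤ (s : Set K) →+* O := ι.codRestrict O hmem
  have hιι' : O.val.toRingHom.comp ι' = ι := rfl
  have := finite_quotient_span_pow (p := p) (O := O) 2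
  obtain ⟨M, hM, hdvd⟩ := exists_pow_C_sq_dvd_scaleHom_sub ι' (p : O) θ
  refine ⟨p, hp, ι, hι, M, hM, fun S c g hinf => ?_⟩
  set τ := θ ^ M
  have hdvd' : ∀ f, C ((p : O) ^ 2) ∣ scaleHom ι' (p : O) (τ⁻¹ f) - scaleHom ι' (p : O) f := by
    intro f
    have h1 := hdvd (τ⁻¹ f)
    rw [← AlgEquiv.mul_apply, mul_inv_cancel, AlgEquiv.one_apply, ← dvd_neg, neg_sub] at h1
    exact h1
  refine eq_univ_of_infinite_of_forall hinf (fun n₀ h => ?_) fun n₀ h => ?_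
  · have h1 := coeffFunctional_pow_eq_zero hp2 O hO ι' S c τ hdvd ((τ ^ n₀) g) ?_ 0
    · rw [pow_zero, AlgEquiv.one_apply] at h1
      exact h1
    · refine h.mono fun n hn => ?_
      change coeffFunctional ι S c ((τ ^ (n₀ + n)) g) = 0 at hn
      rw [add_comm, zpow_add, zpow_natCast] at hn
      exact hn
  · have h1 := coeffFunctional_pow_eq_zero hp2 O hO ι' S c τ⁻¹ hdvd' ((τ ^ n₀) g) ?_ 0
    · rw [pow_zero, AlgEquiv.one_apply] at h1
      exact h1
    · refine h.mono fun n hn => ?_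
      change coeffFunctional ι S c ((τ ^ (n₀ - n)) g) = 0 at hn
      rw [sub_eq_neg_add, zpow_add, zpow_neg, zpow_natCast, ← inv_pow] at hn
      exact hn

end Interpolation

section Separation

open MvPolynomial

theorem exists_notMem_sup_pow_of_isPrimary {A : Type*} [CommRing A] [IsNoetherianRing A]
    {I 𝔪 : Ideal A} (h𝔪 : 𝔪.IsPrime) (hI : I.IsPrimary) (hle : I ≤ 𝔪) {g : A} (hg : g ∉ I) :
    ∃ k : ℕ, g ∉ I ⊔ 𝔪 ^ k := by
  by_contra! h
  have hmem : (Ideal.Quotient.mk I g) ∈ (⨅ i : ℕ, 𝔪 ^ i • ⊤ : Submodule A (A ⧸ I)) := by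
    rw [Submodule.mem_iInf]
    intro k
    obtain ⟨a, ha, b, hb, hab⟩ := Submodule.mem_sup.1 (h k)
    have : Ideal.Quotient.mk I g = b • (1 : A ⧸ I) := by
      rw [← hab, map_add, Ideal.Quotient.eq_zero_iff_mem.2 ha, zero_add, Algebra.smul_def, mul_one]
      rfl
    rw [this]
    exact Submodule.smul_mem_smul hb trivial
  obtain ⟨⟨r, hr⟩, hrg⟩ := (Ideal.mem_iInf_smul_pow_eq_bot_iff 𝔪 _).1 hmem
  have h1 : g * (1 - r) ∈ I := by
    rw [← Ideal.Quotient.eq_zero_iff_mem]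
    rw [Algebra.smul_def] at hrg
    change Ideal.Quotient.mk I r * _ = _ at hrg
    rw [map_mul, map_sub, map_one, mul_sub, mul_one, mul_comm, hrg, sub_self]
  rcases (Ideal.isPrimary_iff.1 hI).2 h1 with h2 | h2
  · exact hg h2
  · have h3 : 1 - r ∈ 𝔪 := (h𝔪.radical_le_iff.2 hle) h2
    exact h𝔪.ne_top ((Ideal.eq_top_iff_one _).2 (by simpa using add_mem h3 hr))

theorem monomial_mem_ker_constantCoeff_pow {K : Type*} [CommRing K] {d : ℕ} (α : Fin d →₀ ℕ)
    (r : K) {k : ℕ} (hk : k ≤ α.degree) :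
    monomial α r ∈ (RingHom.ker (constantCoeff (R := K) (σ := Fin d))) ^ k := by
  refine Ideal.pow_le_pow_right hk ?_
  rw [monomial_eq]
  refine Ideal.mul_mem_left _ _ ?_
  rw [Finsupp.degree_apply, ← Finset.prod_pow_eq_pow_sum]
  exact Ideal.prod_mem_prod fun i _ => Ideal.pow_mem_pow (by simp [RingHom.mem_ker]) _

theorem exists_coeffFunctional_of_isPrimary {R K L : Type*} [CommRing R] [IsDomain R]
    [Field K] [Field L] [Algebra R K] [FaithfulSMul R K] {d : ℕ} (ι : R →+* L) (hι : Function.Injective ι)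
    {I : Ideal (MvPolynomial (Fin d) K)} (hI : I.IsPrimary)
    (hle : I ≤ RingHom.ker constantCoeff) {g : MvPolynomial (Fin d) R}
    (hg : map (algebraMap R K) g ∉ I) :
    ∃ S c, coeffFunctional ι S c g ≠ 0 ∧
      ∀ f, map (algebraMap R K) f ∈ I → coeffFunctional ι S c f = 0 := by
  classical
  obtain ⟨k, hk⟩ := exists_notMem_sup_pow_of_isPrimary
    (RingHom.ker_isPrime (constantCoeff (R := K) (σ := Fin d))) hI hle hg
  set N : Submodule K (MvPolynomial (Fin d) K) :=
    (I ⊔ RingHom.ker constantCoeff ^ k).restrictScalars K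
  obtain ⟨lam, hlam, hN⟩ := Submodule.exists_le_ker_of_notMem (p := N) hk
  let _ : Algebra (FractionRing R) K := FractionRing.liftAlgebra R K
  have : IsScalarTower R (FractionRing R) K := FractionRing.isScalarTower_liftAlgebra R K
  obtain ⟨π, hπ⟩ : ∃ π : K →ₗ[FractionRing R] FractionRing R, π (lam (map (algebraMap R K) g)) ≠ 0 := by
    by_contra! h
    exact hlam ((Module.forall_dual_apply_eq_zero_iff _ _).1 h)
  let ι₀ : FractionRing R →+* L := IsFractionRing.lift hι
  have hι₀ : ∀ r, ι₀ (algebraMap R _ r) = ι r := fun r => IsLocalization.lift_eq _ _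
  have hfin : {α : Fin d →₀ ℕ | α.degree ≤ k}.Finite := Finsupp.finite_of_degree_le k
  have key : ∀ f : MvPolynomial (Fin d) R,
      coeffFunctional ι hfin.toFinset (fun α => ι₀ (π (lam (monomial α 1)))) f =
        ι₀ (π (lam (map (algebraMap R K) f))) := by
    intro f
    have hterm : ∀ α (r : R), ι₀ (π (lam (map (algebraMap R K) (monomial α r)))) =
        ι₀ (π (lam (monomial α 1))) * ι r := by
      intro α r
      have h1 : map (algebraMap R K) (monomial α r) = algebraMap R K r • monomial α (1 : K) := by
        rw [map_monomial, smul_monomial, smul_eq_mul, mul_one]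
      have h2 : algebraMap R K r • lam (monomial α (1 : K)) =
          (algebraMap R (FractionRing R) r) • lam (monomial α (1 : K)) := by
        rw [algebraMap_smul, algebraMap_smul]
      rw [h1, map_smul, h2, map_smul, smul_eq_mul, map_mul, hι₀, mul_comm]
    conv_rhs => rw [f.as_sum]
    simp only [map_sum]
    simp only [hterm]
    rw [coeffFunctional]
    refine Finset.sum_congr_of_eq_on_inter ?_ ?_ fun _ _ _ => rfl
    · intro α _ hα
      rw [notMem_support_iff.1 hα, map_zero, mul_zero]
    · intro α _ hα
      have : lam (monomial α 1) = 0 := by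
        refine hN (Ideal.mem_sup_right (monomial_mem_ker_constantCoeff_pow α 1 ?_))
        by_contra! h
        exact hα (by simpa using h.le)
      rw [this, map_zero, map_zero, zero_mul]
  refine ⟨hfin.toFinset, fun α => ι₀ (π (lam (monomial α 1))), ?_, fun f hf => ?_⟩
  · rw [key]
    exact (map_ne_zero ι₀).2 hπ
  · rw [key, show lam (map (algebraMap R K) f) = 0 from hN (Ideal.mem_sup_left hf), map_zero, map_zero]

end Separation

section Period

open MvPolynomial

/-- Along every class of some modulus, membership in `S` holds finitely often or always. -/
def FiniteOrFullOnClasses (S : Set ℤ) : Prop :=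
  ∃ M : ℕ, 0 < M ∧ ∀ r : ℤ, {n : ℤ | M * n + r ∈ S}.Finite ∨ ∀ n : ℤ, M * n + r ∈ S

theorem FiniteOrFullOnClasses.univ : FiniteOrFullOnClasses Set.univ :=
  ⟨1, one_pos, fun _ => Or.inr fun _ => trivial⟩

theorem FiniteOrFullOnClasses.inter {S T : Set ℤ} (hS : FiniteOrFullOnClasses S)
    (hT : FiniteOrFullOnClasses T) : FiniteOrFullOnClasses (S ∩ T) := by
  obtain ⟨M, hM, hS⟩ := hS
  obtain ⟨N, hN, hT⟩ := hT
  refine ⟨M * N, Nat.mul_pos hM hN, fun r => ?_⟩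
  rcases hS r with h1 | h1
  · refine Or.inl ((h1.preimage (f := fun n : ℤ => N * n) ?_).subset fun n hn => ?_)
    · intro a _ b _ hab
      exact mul_left_cancel₀ (by exact_mod_cast hN.ne') hab
    · have := hn.1
      push_cast at this
      rwa [mul_assoc] at this
  rcases hT r with h2 | h2
  · refine Or.inl ((h2.preimage (f := fun n : ℤ => M * n) ?_).subset fun n hn => ?_)
    · intro a _ b _ hab
      exact mul_left_cancel₀ (by exact_mod_cast hM.ne') hab
    · have := hn.2
      push_cast at this
      rwa [mul_comm (M : ℤ), mul_assoc] at this
  · refine Or.inr fun n => ⟨?_, ?_⟩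
    · have := h1 (N * n)
      push_cast
      rwa [mul_assoc]
    · have := h2 (M * n)
      push_cast
      rwa [mul_comm (M : ℤ), mul_assoc]

theorem FiniteOrFullOnClasses.biInter {ι : Type*} (s : Finset ι) (S : ι → Set ℤ)
    (h : ∀ i ∈ s, FiniteOrFullOnClasses (S i)) : FiniteOrFullOnClasses (⋂ i ∈ s, S i) := by
  classical
  induction s using Finset.induction_on with
  | empty => simpa using FiniteOrFullOnClasses.univ
  | insert i s _ ih =>
    rw [Finset.set_biInter_insert]
    exact (h i (Finset.mem_insert_self i s)).inter
      (ih fun j hj => h j (Finset.mem_insert_of_mem hj))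

theorem FiniteOrFullOnClasses.twoSidedSML {S : Set ℤ} (h : FiniteOrFullOnClasses S) :
    TwoSidedSML S := by
  classical
  obtain ⟨M, hM, hS⟩ := h
  have hM' : (0 : ℤ) < M := by exact_mod_cast hM
  let P : Finset ℤ := {r ∈ Finset.Ico 0 (M : ℤ) | ∀ n : ℤ, M * n + r ∈ S}
  let Q : Finset ℤ := {r ∈ Finset.Ico 0 (M : ℤ) | {n : ℤ | M * n + r ∈ S}.Finite}
  refine ⟨P.image fun r => ((M : ℤ), r),
    ⋃ r ∈ Q, (fun n : ℤ => M * n + r) '' {n : ℤ | M * n + r ∈ S}, ?_, ?_⟩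
  · exact Q.finite_toSet.biUnion fun r hr => (Finset.mem_filter.1 hr).2.image _
  · ext k
    simp only [Set.mem_union, Set.mem_iUnion, Finset.mem_image, exists_prop, Set.mem_ofPred_eq,
      Set.mem_image]
    constructor
    · intro hk
      have hr : k % M ∈ Finset.Ico 0 (M : ℤ) :=
        Finset.mem_Ico.2 ⟨Int.emod_nonneg _ hM'.ne', Int.emod_lt_of_pos _ hM'⟩
      have hdiv : (M : ℤ) * (k / M) + k % M = k := Int.mul_ediv_add_emod _ _
      rcases hS (k % M) with h1 | h1
      · exact Or.inr ⟨k % M, Finset.mem_filter.2 ⟨hr, h1⟩, k / M, by rwa [hdiv], hdiv⟩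
      · exact Or.inl ⟨_, ⟨k % M, Finset.mem_filter.2 ⟨hr, h1⟩, rfl⟩, k / M, hdiv.symm⟩
    · rintro (⟨_, ⟨r, hr, rfl⟩, n, rfl⟩ | ⟨r, _, n, hn, rfl⟩)
      · exact (Finset.mem_filter.1 hr).2 n
      · exact hn

theorem exists_algEquiv_map_comm {R K : Type*} [CommRing R] [CommRing K] [Algebra R K] {σ : Type*}
    (hinj : Function.Injective (algebraMap R K))
    (θ : MvPolynomial σ K ≃ₐ[K] MvPolynomial σ K)
    (h1 : ∀ i, ∃ q, map (algebraMap R K) q = θ (X i))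
    (h2 : ∀ i, ∃ q, map (algebraMap R K) q = θ.symm (X i)) :
    ∃ θR : MvPolynomial σ R ≃ₐ[R] MvPolynomial σ R,
      ∀ q, map (algebraMap R K) (θR q) = θ (map (algebraMap R K) q) := by
  choose u hu using h1
  choose v hv using h2
  have key : ∀ (ψ : MvPolynomial σ K →ₐ[K] MvPolynomial σ K) (w : σ → MvPolynomial σ R),
      (∀ i, map (algebraMap R K) (w i) = ψ (X i)) →
      ∀ q, map (algebraMap R K) (aeval w q) = ψ (map (algebraMap R K) q) := by
    intro ψ w hw q
    induction q using MvPolynomial.induction_on with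
    | C a => simp [← MvPolynomial.algebraMap_eq]
    | add p q hp hq => simp only [map_add, hp, hq]
    | mul_X p i hp => simp only [map_mul, hp, aeval_X, map_X, hw]
  have ku := key θ u hu
  have kv := key θ.symm v hv
  refine ⟨AlgEquiv.ofAlgHom (aeval u) (aeval v) ?_ ?_, ku⟩
  · refine AlgHom.ext fun q => map_injective _ hinj ?_
    have h3 := ku (aeval v q)
    rw [kv] at h3
    exact h3.trans (θ.apply_symm_apply _)
  · refine AlgHom.ext fun q => map_injective _ hinj ?_
    have h3 := kv (aeval u q)
    rw [ku] at h3
    exact h3.trans (θ.symm_apply_apply _)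

theorem map_zpow_comm {R K : Type*} [CommRing R] [CommRing K] [Algebra R K] {σ : Type*}
    {θ : MvPolynomial σ K ≃ₐ[K] MvPolynomial σ K} {θR : MvPolynomial σ R ≃ₐ[R] MvPolynomial σ R}
    (h : ∀ q, map (algebraMap R K) (θR q) = θ (map (algebraMap R K) q)) (n : ℤ)
    (q : MvPolynomial σ R) :
    map (algebraMap R K) ((θR ^ n) q) = (θ ^ n) (map (algebraMap R K) q) := by
  have h' : ∀ q, map (algebraMap R K) (θR⁻¹ q) = θ⁻¹ (map (algebraMap R K) q) := by
    intro q
    apply θ.injective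
    rw [← h, ← AlgEquiv.mul_apply, ← AlgEquiv.mul_apply, mul_inv_cancel, mul_inv_cancel]
    rfl
  induction n generalizing q with
  | zero => rfl
  | succ n ih => rw [zpow_add_one, zpow_add_one, AlgEquiv.mul_apply, AlgEquiv.mul_apply, ih, h]
  | pred n ih => rw [zpow_sub_one, zpow_sub_one, AlgEquiv.mul_apply, AlgEquiv.mul_apply, ih, h']

theorem finiteOrFullOnClasses_of_le_ker_constantCoeff {K : Type*} [Field K] [CharZero K] {d : ℕ}
    (θ : MvPolynomial (Fin d) K ≃ₐ[K] MvPolynomial (Fin d) K)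
    {I : Ideal (MvPolynomial (Fin d) K)} (hI : I.IsPrimary) (hle : I ≤ RingHom.ker constantCoeff)
    (f : MvPolynomial (Fin d) K) : FiniteOrFullOnClasses {n : ℤ | (θ ^ n) f ∈ I} := by
  classical
  let s : Finset K := (Finset.univ.biUnion fun i => (θ (X i)).coeffs) ∪
    (Finset.univ.biUnion fun i => (θ.symm (X i)).coeffs) ∪ f.coeffs
  have hs : ∀ q : MvPolynomial (Fin d) K, q.coeffs ⊆ s →
      ∃ q', map (algebraMap (Algebra.adjoin ℤ (s : Set K)) K) q' = q := by
    intro q hq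
    refine (mem_range_map_iff_coeffs_subset).2 fun x hx => ?_
    exact ⟨⟨x, Algebra.subset_adjoin (hq hx)⟩, rfl⟩
  have hsu : ∀ i, (θ (X i)).coeffs ⊆ s := fun i x hx => Finset.mem_union_left _
    (Finset.mem_union_left _ (Finset.mem_biUnion.2 ⟨i, Finset.mem_univ i, hx⟩))
  have hsv : ∀ i, (θ.symm (X i)).coeffs ⊆ s := fun i x hx => Finset.mem_union_left _
    (Finset.mem_union_right _ (Finset.mem_biUnion.2 ⟨i, Finset.mem_univ i, hx⟩))
  obtain ⟨f', hf'⟩ := hs f Finset.subset_union_right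
  obtain ⟨θR, hθR⟩ := exists_algEquiv_map_comm Subtype.val_injective θ
    (fun i => hs _ (hsu i)) fun i => hs _ (hsv i)
  obtain ⟨p, hp, ι, hι, M, hM, hper⟩ := exists_period_coeffFunctional s θR
  refine ⟨M, hM, fun r => ?_⟩
  by_contra! hcon
  obtain ⟨hinf, n₁, hn₁⟩ := hcon
  have hpow : ∀ n : ℤ, map (algebraMap (Algebra.adjoin ℤ (s : Set K)) K)
      (((θR ^ M) ^ n) ((θR ^ r) f')) = (θ ^ (M * n + r)) f := by
    intro n
    rw [← zpow_natCast θR M, ← zpow_mul, ← AlgEquiv.mul_apply, ← zpow_add, map_zpow_comm hθR, hf']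
  obtain ⟨S, c, hne, hzero⟩ := exists_coeffFunctional_of_isPrimary ι hι hI hle
    (g := ((θR ^ M) ^ n₁) ((θR ^ r) f')) (by rwa [hpow])
  refine hne (hper S c _ (Set.Infinite.mono (fun n hn => hzero _ ?_) hinf) n₁)
  rw [hpow]
  exact hn

end Period

section Descent

open MvPolynomial

theorem exists_algEquiv_constantCoeff_eq_aeval {K σ : Type*} [CommRing K] (a : σ → K) :
    ∃ e : MvPolynomial σ K ≃ₐ[K] MvPolynomial σ K, ∀ q, constantCoeff (e q) = aeval a q := by
  refine ⟨AlgEquiv.ofAlgHom (aeval fun i => X i + C (a i)) (aeval fun i => X i - C (a i))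
    (algHom_ext fun i => by simp [← MvPolynomial.algebraMap_eq])
    (algHom_ext fun i => by simp [← MvPolynomial.algebraMap_eq]), fun q => ?_⟩
  rw [AlgEquiv.ofAlgHom_apply]
  induction q using MvPolynomial.induction_on with
  | C r => simp [← MvPolynomial.algebraMap_eq]
  | add p q hp hq => simp only [map_add, hp, hq]
  | mul_X p i hp =>
    rw [map_mul, map_mul, map_mul, hp, aeval_X, aeval_X]
    simp

theorem zpow_apply_mem_iff_conj {K A : Type*} [CommRing K] [CommRing A] [Algebra K A]
    (θ e : A ≃ₐ[K] A) (I : Ideal A) (f : A) (n : ℤ) :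
    ((e * θ * e⁻¹) ^ n) (e f) ∈ I.comap (e.symm : A →+* A) ↔ (θ ^ n) f ∈ I := by
  have h1 : (e * θ ^ n * e⁻¹) (e f) = e ((θ ^ n) f) := by
    rw [AlgEquiv.mul_apply, AlgEquiv.mul_apply, ← AlgEquiv.mul_apply e⁻¹ e, inv_mul_cancel,
      AlgEquiv.one_apply]
  have h2 : (e.symm : A →+* A) (e ((θ ^ n) f)) = (θ ^ n) f := e.symm_apply_apply _
  rw [conj_zpow, h1, Ideal.mem_comap, h2]

theorem finiteOrFullOnClasses_of_isPrimary {K : Type*} [Field K] [CharZero K] [IsAlgClosed K]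
    {d : ℕ} (θ : MvPolynomial (Fin d) K ≃ₐ[K] MvPolynomial (Fin d) K)
    {I : Ideal (MvPolynomial (Fin d) K)} (hI : I.IsPrimary) (f : MvPolynomial (Fin d) K) :
    FiniteOrFullOnClasses {n : ℤ | (θ ^ n) f ∈ I} := by
  obtain ⟨𝔪, hmax, hle⟩ := I.exists_le_maximal hI.ne_top
  obtain ⟨a, rfl⟩ := (isMaximal_iff_eq_vanishingIdeal_singleton (K := K)).1 hmax
  obtain ⟨e, he⟩ := exists_algEquiv_constantCoeff_eq_aeval a
  have h := finiteOrFullOnClasses_of_le_ker_constantCoeff (e * θ * e⁻¹)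
    (hI.comap (e.symm : MvPolynomial (Fin d) K →+* MvPolynomial (Fin d) K)) (fun q hq => by
      have h1 : aeval a (e.symm q) = 0 :=
        (mem_vanishingIdeal_singleton_iff _ _).1 (hle (Ideal.mem_comap.1 hq))
      rw [RingHom.mem_ker, ← h1, ← he, e.apply_symm_apply]) (e f)
  simpa only [zpow_apply_mem_iff_conj] using h

theorem finiteOrFullOnClasses_of_isAlgClosed {K : Type*} [Field K] [CharZero K] [IsAlgClosed K]
    {d : ℕ} (θ : MvPolynomial (Fin d) K ≃ₐ[K] MvPolynomial (Fin d) K)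
    (I : Ideal (MvPolynomial (Fin d) K)) (f : MvPolynomial (Fin d) K) :
    FiniteOrFullOnClasses {n : ℤ | (θ ^ n) f ∈ I} := by
  obtain ⟨s, hs, hprim⟩ := Submodule.isLasker (MvPolynomial (Fin d) K) (MvPolynomial (Fin d) K) I
  convert FiniteOrFullOnClasses.biInter s (fun Q => {n : ℤ | (θ ^ n) f ∈ Q})
    fun Q hQ => finiteOrFullOnClasses_of_isPrimary θ (hprim hQ) f using 1
  ext n
  simp [← hs]

theorem map_mem_map_iff {K L : Type*} [Field K] [Field L] [Algebra K L] {σ : Type*}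
    (I : Ideal (MvPolynomial σ K)) (f : MvPolynomial σ K) :
    map (algebraMap K L) f ∈ I.map (map (algebraMap K L)) ↔ f ∈ I := by
  let _ : Algebra (MvPolynomial σ K) (MvPolynomial σ L) := algebraMvPolynomial
  have : Module.Free (MvPolynomial σ K) (MvPolynomial σ L) :=
    (Algebra.IsPushout.out (R := K) (S := MvPolynomial σ K) (R' := L)
      (S' := MvPolynomial σ L)).free
  have h := Ideal.comap_map_eq_self_of_faithfullyFlat (B := MvPolynomial σ L) I
  conv_rhs => rw [← h]
  rfl

theorem exists_algEquiv_map_comm_extension {R K : Type*} [CommRing R] [CommRing K] [Algebra R K]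
    {σ : Type*} (θ : MvPolynomial σ R ≃ₐ[R] MvPolynomial σ R) :
    ∃ θK : MvPolynomial σ K ≃ₐ[K] MvPolynomial σ K,
      ∀ q, map (algebraMap R K) (θ q) = θK (map (algebraMap R K) q) := by
  have key : ∀ (ψ : MvPolynomial σ R →ₐ[R] MvPolynomial σ R) (q : MvPolynomial σ R),
      aeval (fun i => map (algebraMap R K) (ψ (X i))) (map (algebraMap R K) q) =
        map (algebraMap R K) (ψ q) := by
    intro ψ q
    induction q using MvPolynomial.induction_on with
    | C a => simp [← MvPolynomial.algebraMap_eq]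
    | add p q hp hq => simp only [map_add, hp, hq]
    | mul_X p i hp => simp only [map_mul, hp, aeval_X, map_X]
  refine ⟨AlgEquiv.ofAlgHom (aeval fun i => map (algebraMap R K) (θ (X i)))
    (aeval fun i => map (algebraMap R K) (θ.symm (X i))) ?_ ?_, fun q => (key θ q).symm⟩
  · refine algHom_ext fun i => ?_
    rw [AlgHom.comp_apply, aeval_X]
    exact (key θ _).trans (by simp)
  · refine algHom_ext fun i => ?_
    rw [AlgHom.comp_apply, aeval_X]
    exact (key θ.symm _).trans (by simp)

theorem finiteOrFullOnClasses_zpow_apply_mem {K : Type*} [Field K] [CharZero K] {d : ℕ}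
    (θ : MvPolynomial (Fin d) K ≃ₐ[K] MvPolynomial (Fin d) K)
    (I : Ideal (MvPolynomial (Fin d) K)) (f : MvPolynomial (Fin d) K) :
    FiniteOrFullOnClasses {n : ℤ | (θ ^ n) f ∈ I} := by
  obtain ⟨θ', hθ'⟩ := exists_algEquiv_map_comm_extension (K := AlgebraicClosure K) θ
  have : CharZero (AlgebraicClosure K) := charZero_of_injective_algebraMap
    (algebraMap K (AlgebraicClosure K)).injective
  convert finiteOrFullOnClasses_of_isAlgClosed θ' (I.map (map (algebraMap K _)))
    (map (algebraMap K _) f) using 3 with n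
  rw [← map_zpow_comm hθ', map_mem_map_iff]

end Descent

/-- **Generalized Skolem–Mahler–Lech theorem: the polynomial ring case.**
Let `K` be a field of characteristic zero and `A = K[x₁, …, x_d]`. If `σ` is a
`K`-algebra automorphism of `A` and `I`, `J` are ideals of `A`, then the set
`{n ∈ ℤ : σⁿ(I) ⊇ J}` has the two-sided SML property. -/
theorem stmt13 {K : Type*} [Field K] [CharZero K] (d : ℕ)
    (σ : MvPolynomial (Fin d) K ≃ₐ[K] MvPolynomial (Fin d) K)
    (I J : Ideal (MvPolynomial (Fin d) K)) :
    TwoSidedSML {n : ℤ | J ≤ I.map (σ ^ n : MvPolynomial (Fin d) K ≃ₐ[K] MvPolynomial (Fin d) K)} := by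
  obtain ⟨s, hs⟩ := IsNoetherian.noetherian J
  refine FiniteOrFullOnClasses.twoSidedSML ?_
  convert FiniteOrFullOnClasses.biInter s (fun f => {n : ℤ | (σ⁻¹ ^ n) f ∈ I})
    fun f _ => finiteOrFullOnClasses_zpow_apply_mem σ⁻¹ I f using 1
  ext n
  rw [← hs, Set.mem_ofPred_eq, Submodule.span_le]
  simp only [Set.mem_iInter, Set.mem_ofPred_eq]
  refine forall₂_congr fun f _ => ?_
  rw [SetLike.mem_coe, Ideal.mem_map_of_equiv, inv_zpow]
  constructor
  · rintro ⟨x, hx, rfl⟩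
    rwa [← AlgEquiv.mul_apply, inv_mul_cancel]
  · intro h
    exact ⟨_, h, by rw [← AlgEquiv.mul_apply, mul_inv_cancel, AlgEquiv.one_apply]⟩
end

section
/- Let p ≥ 5 be a prime and let I and J be two p-reduced ideals in ℤ_p[x₁, …, x_d]. Suppose that (ℤ_p[x₁, …, x_d]/I) ⊗_{ℤ_p} ℚ_p is finite-dimensional as a ℚ_p-vector space. If σ is a ℤ_p-algebra automorphism of ℤ_p[x₁, …, x_d], then the set {n ∈ ℤ : σ^n(I) ⊇ J} has the two-sided SML property. -/
open TensorProduct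

/-- A proper ideal `I` of a `ℤ_p`-algebra `A` is `p`-reduced if `p·x ∈ I`
implies `x ∈ I`. -/
def PReduced (p : ℕ) {A : Type*} [CommRing A] (I : Ideal A) : Prop :=
  I ≠ ⊤ ∧ ∀ x : A, (p : A) * x ∈ I → x ∈ I

open Polynomial in
theorem norm_coeff_le_of_eq_X_sub_C_mul {K : Type*} [NormedField K] [IsUltrametricDist K]
    {P Q : K[X]} {t : K} (ht : ‖t‖ ≤ 1) (hPQ : P = (X - C t) * Q) {k : ℕ} {ε : ℝ} (hε : 0 ≤ ε)
    (hP : ∀ j, k + 1 ≤ j → ‖P.coeff j‖ ≤ ε) {j : ℕ} (hj : k ≤ j) : ‖Q.coeff j‖ ≤ ε := by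
  have key : ∀ m j, k ≤ j → Q.natDegree < j + m → ‖Q.coeff j‖ ≤ ε := by
    intro m
    induction m with
    | zero =>
      intro j _ h
      rw [coeff_eq_zero_of_natDegree_lt (by simpa using h), norm_zero]
      exact hε
    | succ m ih =>
      intro j hj h
      have h1 : Q.coeff j = P.coeff (j + 1) + t * Q.coeff (j + 1) := by
        rw [hPQ, sub_mul, coeff_sub, coeff_X_mul, coeff_C_mul]
        ring
      rw [h1]
      refine (IsUltrametricDist.norm_add_le_max _ _).trans (max_le (hP _ (by omega)) ?_)
      rw [norm_mul]
      exact (mul_le_of_le_one_left (norm_nonneg _) ht).trans (ih _ (by omega) (by omega))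
  exact key (Q.natDegree + 1) j hj (by omega)

open Polynomial in
theorem norm_eval_le_of_forall_isRoot {K : Type*} [NormedField K] [IsUltrametricDist K]
    {ε : ℝ} (hε : 0 ≤ ε) (s : Finset K) (hs : ∀ t ∈ s, ‖t‖ ≤ 1) (P : K[X])
    (hroot : ∀ t ∈ s, P.IsRoot t) (hP : ∀ j, s.card ≤ j → ‖P.coeff j‖ ≤ ε) {x : K}
    (hx : ‖x‖ ≤ 1) : ‖P.eval x‖ ≤ ε := by
  classical
  induction s using Finset.induction_on generalizing P with
  | empty =>
    rw [eval_eq_sum_range]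
    refine IsUltrametricDist.norm_sum_le_of_forall_le_of_nonneg hε fun i _ => ?_
    rw [norm_mul, norm_pow]
    exact (mul_le_of_le_one_right (norm_nonneg _) (pow_le_one₀ (norm_nonneg _) hx)).trans
      (hP i (by simp))
  | insert a s ha ih =>
    obtain ⟨Q, hQ⟩ := dvd_iff_isRoot.mpr (hroot a (Finset.mem_insert_self a s))
    have ha1 := hs a (Finset.mem_insert_self a s)
    rw [Finset.card_insert_of_notMem ha] at hP
    have h := ih (fun t ht => hs t (Finset.mem_insert_of_mem ht)) Q (fun t ht => by
      have h1 := hroot t (Finset.mem_insert_of_mem ht)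
      rw [hQ, IsRoot.def, eval_mul, mul_eq_zero] at h1
      refine h1.resolve_left ?_
      rw [eval_sub, eval_X, eval_C, sub_eq_zero]
      rintro rfl
      exact ha ht) (fun j hj => norm_coeff_le_of_eq_X_sub_C_mul ha1 hQ hε hP hj)
    rw [hQ, eval_mul, norm_mul, eval_sub, eval_X, eval_C]
    refine (mul_le_of_le_one_left (norm_nonneg _) ?_).trans h
    rw [sub_eq_add_neg]
    exact (IsUltrametricDist.norm_add_le_max _ _).trans (max_le hx (by rwa [norm_neg]))

theorem exists_norm_pow_div_factorial_le (p : ℕ) [Fact p.Prime] (hp : 3 ≤ p) {ε : ℝ}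
    (hε : 0 < ε) : ∃ k₀ : ℕ, ∀ i, k₀ ≤ i → ‖(p : ℚ_[p]) ^ i / (i.factorial : ℚ_[p])‖ ≤ ε := by
  have hp1 : (1 : ℝ) < p := by exact_mod_cast (by omega : 1 < p)
  obtain ⟨k, hk⟩ := exists_pow_lt_of_lt_one hε (inv_lt_one_of_one_lt₀ hp1)
  refine ⟨2 * k, fun i hi => ?_⟩
  have hv : 2 * padicValNat p i.factorial ≤ i := by
    have h := sub_one_mul_padicValNat_factorial (p := p) i
    have h2 : 2 * padicValNat p i.factorial ≤ (p - 1) * padicValNat p i.factorial :=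
      Nat.mul_le_mul_right _ (by omega)
    omega
  have hn : ‖(i.factorial : ℚ_[p])‖ = ((p : ℝ) ^ padicValNat p i.factorial)⁻¹ := by
    rw [Padic.norm_eq_zpow_neg_valuation (by exact_mod_cast i.factorial_ne_zero),
      Padic.valuation_natCast, zpow_neg, zpow_natCast]
  rw [norm_div, norm_pow, Padic.norm_p, hn, div_inv_eq_mul]
  obtain ⟨m, hm⟩ := Nat.exists_eq_add_of_le (by omega : k + padicValNat p i.factorial ≤ i)
  refine le_trans ?_ hk.le
  have hinv : (p : ℝ)⁻¹ ≤ 1 := (inv_lt_one_of_one_lt₀ hp1).le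
  generalize padicValNat p i.factorial = v at hm
  rw [hm, pow_add, pow_add, inv_pow _ v]
  have h0 : (p : ℝ) ^ v ≠ 0 := by positivity
  calc _ = (p : ℝ)⁻¹ ^ k * (p : ℝ)⁻¹ ^ m := by field_simp
    _ ≤ _ := mul_le_of_le_one_right (by positivity) (pow_le_one₀ (by positivity) hinv)

open Polynomial in
/-- A weak form of Strassmann's theorem, for Newton series whose `k`-th coefficient is divisible
by `p ^ k`. -/
theorem newtonSeries_eq_zero_of_infinite_zeros (p : ℕ) [Fact p.Prime] (hp : 3 ≤ p)
    (b : ℕ → ℤ_[p])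
    (hinf : {n : ℕ | ∑ k ∈ Finset.range (n + 1), (n.choose k : ℤ_[p]) * (p ^ k * b k) = 0}.Infinite)
    (n : ℕ) : ∑ k ∈ Finset.range (n + 1), (n.choose k : ℤ_[p]) * (p ^ k * b k) = 0 := by
  classical
  let s : ℕ → ℤ_[p] := fun n => ∑ k ∈ Finset.range (n + 1), (n.choose k : ℤ_[p]) * (p ^ k * b k)
  change s n = 0
  let R : ℕ → ℚ_[p][X] := fun m => ∑ i ∈ Finset.range (m + 1),
    C ((b i : ℚ_[p]) * ((p : ℚ_[p]) ^ i / (i.factorial : ℚ_[p]))) * descPochhammer ℚ_[p] i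
  have hR : ∀ m n, n ≤ m → (R m).eval (n : ℚ_[p]) = (s n : ℚ_[p]) := by
    intro m n hnm
    have h1 : (s n : ℚ_[p]) = ∑ k ∈ Finset.range (n + 1),
        (n.choose k : ℚ_[p]) * (p ^ k * (b k : ℚ_[p])) := by
      simp [s]
    rw [h1, eval_finsetSum]
    rw [← Finset.sum_subset (Finset.range_mono (by omega : n + 1 ≤ m + 1))]
    · refine Finset.sum_congr rfl fun k _ => ?_
      rw [eval_mul, eval_C, descPochhammer_eval_eq_descFactorial,
        Nat.descFactorial_eq_factorial_mul_choose]
      have : (k.factorial : ℚ_[p]) ≠ 0 := by exact_mod_cast k.factorial_ne_zero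
      push_cast
      field_simp
    · intro k _ hk
      rw [eval_mul, descPochhammer_eval_eq_descFactorial,
        Nat.descFactorial_eq_zero_iff_lt.mpr (by simpa using hk)]
      simp
  have hcoeff : ∀ k₀ ε, (∀ i, k₀ ≤ i → ‖(p : ℚ_[p]) ^ i / (i.factorial : ℚ_[p])‖ ≤ ε) → 0 ≤ ε →
      ∀ m j, k₀ ≤ j → ‖(R m).coeff j‖ ≤ ε := by
    intro k₀ ε hk hε m j hj
    rw [finsetSum_coeff]
    refine IsUltrametricDist.norm_sum_le_of_forall_le_of_nonneg hε fun i _ => ?_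
    rw [coeff_C_mul]
    by_cases hij : i < j
    · rw [coeff_eq_zero_of_natDegree_lt (by rwa [descPochhammer_natDegree]), mul_zero, norm_zero]
      exact hε
    · rw [norm_mul, norm_mul]
      have h1 : ‖(descPochhammer ℚ_[p] i).coeff j‖ ≤ 1 := by
        rw [← descPochhammer_map (Int.castRingHom ℚ_[p]), coeff_map]
        exact Padic.norm_int_le_one _
      calc _ ≤ 1 * ε * 1 := by
            gcongr
            · exact PadicInt.norm_le_one _
            · exact hk i (by omega)
        _ = ε := by ring
  have hle : ∀ ε > 0, ‖(s n : ℚ_[p])‖ ≤ ε := by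
    intro ε hε
    obtain ⟨k₀, hk₀⟩ := exists_norm_pow_div_factorial_le p hp hε
    obtain ⟨t, ht, htc⟩ := hinf.exists_subset_card_eq k₀
    let m := max n (t.sup id)
    rw [← hR m n (le_max_left _ _)]
    refine norm_eval_le_of_forall_isRoot hε.le (t.image (Nat.cast : ℕ → ℚ_[p])) ?_ _ ?_ ?_ ?_
    · intro x hx
      obtain ⟨y, -, rfl⟩ := Finset.mem_image.mp hx
      exact_mod_cast Padic.norm_int_le_one (p := p) (y : ℤ)
    · intro x hx
      obtain ⟨y, hy, rfl⟩ := Finset.mem_image.mp hx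
      rw [IsRoot.def, hR m y ((Finset.le_sup (f := id) hy).trans (le_max_right _ _))]
      exact PadicInt.coe_eq_zero.mpr (ht hy)
    · rw [Finset.card_image_of_injective _ Nat.cast_injective, htc]
      exact hcoeff k₀ ε hk₀ hε.le m
    · exact_mod_cast Padic.norm_int_le_one (p := p) (n : ℤ)
  have h0 : ‖(s n : ℚ_[p])‖ = 0 := le_antisymm (le_of_forall_pos_le_add fun ε hε => by
    simpa using hle ε hε) (norm_nonneg _)
  exact PadicInt.coe_eq_zero.mp (norm_eq_zero.mp h0)

theorem newtonSeries_eq_zero_of_infinite_zeros_of_finite (p : ℕ) [Fact p.Prime] (hp : 3 ≤ p)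
    {M : Type*} [AddCommGroup M] [Module ℤ_[p] M] [Module.Finite ℤ_[p] M]
    [Module.IsTorsionFree ℤ_[p] M] (b : ℕ → M)
    (hinf : {n : ℕ | ∑ k ∈ Finset.range (n + 1),
      (n.choose k : ℤ_[p]) • ((p : ℤ_[p]) ^ k • b k) = 0}.Infinite) (n : ℕ) :
    ∑ k ∈ Finset.range (n + 1), (n.choose k : ℤ_[p]) • ((p : ℤ_[p]) ^ k • b k) = 0 := by
  have : Module.Free ℤ_[p] M := Module.free_of_finite_type_torsion_free'
  refine (Module.Free.chooseBasis ℤ_[p] M).ext_elem fun i => ?_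
  have h := newtonSeries_eq_zero_of_infinite_zeros p hp
    (fun k => (Module.Free.chooseBasis ℤ_[p] M).repr (b k) i) (hinf.mono fun m hm => by
      have h := congrArg (fun x => (Module.Free.chooseBasis ℤ_[p] M).repr x i) hm
      simpa [Finsupp.finsetSum_apply] using h) n
  simpa [Finsupp.finsetSum_apply] using h

section
variable {C : Type*} [CommRing C]

open MvPolynomial

theorem MvPolynomial.exists_algHom_apply_eq_add_mul {ι : Type*} {q : C}
    {τ : MvPolynomial ι C →ₐ[C] MvPolynomial ι C}
    (hτ : ∀ i, ∃ w, τ (X i) = X i + MvPolynomial.C q * w) (u : MvPolynomial ι C) :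
    ∃ w, τ u = u + MvPolynomial.C q * w := by
  induction u using MvPolynomial.induction_on with
  | C a => exact ⟨0, by simp [algHom_C, algebraMap_eq]⟩
  | add u v hu hv =>
    obtain ⟨w, hw⟩ := hu
    obtain ⟨z, hz⟩ := hv
    exact ⟨w + z, by rw [map_add, hw, hz]; ring⟩
  | mul_X u i hu =>
    obtain ⟨w, hw⟩ := hu
    obtain ⟨z, hz⟩ := hτ i
    exact ⟨w * X i + u * z + MvPolynomial.C q * w * z, by rw [map_mul, hw, hz]; ring⟩

theorem MvPolynomial.exists_iterate_eq_sum_choose {ι : Type*} {q : C}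
    {τ : MvPolynomial ι C →ₐ[C] MvPolynomial ι C}
    (hτ : ∀ i, ∃ w, τ (X i) = X i + MvPolynomial.C q * w) (u : MvPolynomial ι C) :
    ∃ w : ℕ → MvPolynomial ι C, ∀ n, (τ ^ n) u =
      ∑ k ∈ Finset.range (n + 1),
        (n.choose k : MvPolynomial ι C) * (MvPolynomial.C q ^ k * w k) := by
  let T : Module.End C (MvPolynomial ι C) := τ.toLinearMap
  let D : Module.End C (MvPolynomial ι C) := T - 1
  have hD : ∀ k, ∃ w, (D ^ k) u = MvPolynomial.C q ^ k * w := by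
    intro k
    induction k with
    | zero => exact ⟨u, by simp⟩
    | succ k ih =>
      obtain ⟨w, hw⟩ := ih
      obtain ⟨z, hz⟩ := exists_algHom_apply_eq_add_mul hτ w
      refine ⟨z, ?_⟩
      have hq : τ (MvPolynomial.C q) = MvPolynomial.C q := τ.commutes q
      rw [pow_succ', Module.End.mul_apply, hw]
      change τ _ - MvPolynomial.C q ^ k * w = _
      rw [map_mul, map_pow, hq, hz]
      ring
  choose w hw using hD
  refine ⟨w, fun n => ?_⟩
  have h1 : (τ ^ n) u = (T ^ n) u := by
    clear w hw
    induction n generalizing u with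
    | zero => rfl
    | succ n ih => rw [pow_succ, pow_succ, AlgHom.mul_apply, Module.End.mul_apply, ih]; rfl
  have h2 : T = D + 1 := by simp [D]
  rw [h1, h2, (Commute.one_right D).add_pow, LinearMap.sum_apply]
  refine Finset.sum_congr rfl fun k _ => ?_
  rw [one_pow, mul_one, ← hw, ← Nat.cast_comm, ← nsmul_eq_mul, ← nsmul_eq_mul,
    LinearMap.smul_apply]

/-- First-order Taylor expansion, with remainder divisible by `q ^ 2`. -/
theorem MvPolynomial.exists_aeval_add_mul_eq {ι : Type*} [Fintype ι] (q : C) (c : ι → C)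
    (P : MvPolynomial ι C) :
    ∃ (a₀ : C) (a : ι → C) (w : MvPolynomial ι C),
      aeval (fun i => MvPolynomial.C (c i) + MvPolynomial.C q * X i) P =
        MvPolynomial.C a₀ + MvPolynomial.C q * ∑ j, MvPolynomial.C (a j) * X j +
          MvPolynomial.C q ^ 2 * w := by
  classical
  induction P using MvPolynomial.induction_on with
  | C r => exact ⟨r, 0, 0, by simp [algebraMap_eq]⟩
  | add u v hu hv =>
    obtain ⟨a₀, a, w, h⟩ := hu
    obtain ⟨b₀, b, z, h'⟩ := hv
    refine ⟨a₀ + b₀, a + b, w + z, ?_⟩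
    simp only [map_add, h, h', Pi.add_apply, add_mul, Finset.sum_add_distrib]
    ring
  | mul_X u i hu =>
    obtain ⟨a₀, a, w, h⟩ := hu
    refine ⟨a₀ * c i, fun j => a j * c i + if j = i then a₀ else 0,
      w * (MvPolynomial.C (c i) + MvPolynomial.C q * X i) +
        (∑ j, MvPolynomial.C (a j) * X j) * X i, ?_⟩
    have h1 : ∑ j, MvPolynomial.C (a j * c i + if j = i then a₀ else 0) * X j =
        (∑ j, MvPolynomial.C (a j) * X j) * MvPolynomial.C (c i) + MvPolynomial.C a₀ * X i := by
      simp only [map_add, map_mul, add_mul, Finset.sum_add_distrib, Finset.sum_mul]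
      congr 1
      · exact Finset.sum_congr rfl fun j _ => by ring
      · simp [apply_ite, ite_mul]
    rw [map_mul, h, aeval_X, h1, map_mul]
    ring

theorem MvPolynomial.exists_pow_comp_eq {ι : Type*} [Finite ι] {S : Type*} [CommRing S]
    [Algebra C S] [Finite S] (σ : MvPolynomial ι C ≃ₐ[C] MvPolynomial ι C) :
    ∃ N : ℕ, 0 < N ∧ ∀ (θ : MvPolynomial ι C →ₐ[C] S) f, θ ((σ ^ N) f) = θ f := by
  have : Finite (MvPolynomial ι C →ₐ[C] S) :=
    Finite.of_injective (fun θ i => θ (X i)) fun θ θ' h => algHom_ext fun i => congrFun h i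
  let e : Equiv.Perm (MvPolynomial ι C →ₐ[C] S) :=
    { toFun := fun θ => θ.comp σ
      invFun := fun θ => θ.comp σ.symm
      left_inv := fun θ => by ext; simp
      right_inv := fun θ => by ext; simp }
  have he : ∀ n θ f, (e ^ n) θ f = θ ((σ ^ n) f) := by
    intro n
    induction n with
    | zero => intro θ f; rfl
    | succ n ih =>
      intro θ f
      rw [pow_succ, Equiv.Perm.mul_apply, ih, pow_succ', AlgEquiv.mul_apply]
      rfl
  refine ⟨orderOf e, orderOf_pos e, fun θ f => ?_⟩
  rw [← he, pow_orderOf_eq_one]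
  rfl

theorem finite_zeros_or_eq_univ_of_quotient_comp_eq (p : ℕ) [Fact p.Prime] (hp : 3 ≤ p)
    [Algebra ℤ_[p] C] [Module.Finite ℤ_[p] C] [Module.IsTorsionFree ℤ_[p] C]
    {ι : Type*} [Fintype ι] (Ψ : MvPolynomial ι C →ₐ[C] MvPolynomial ι C)
    (hΨ : ∀ (θ : MvPolynomial ι C →ₐ[C] C ⧸ Ideal.span {(p : C) ^ 2}) f, θ (Ψ f) = θ f)
    (c : ι → C) (f : MvPolynomial ι C) :
    {n : ℕ | aeval c ((Ψ ^ n) f) = 0}.Finite ∨ ∀ n, aeval c ((Ψ ^ n) f) = 0 := by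
  classical
  let ψ : MvPolynomial ι C →ₐ[C] MvPolynomial ι C :=
    aeval fun i => MvPolynomial.C (c i) + MvPolynomial.C (p : C) * X i
  have hψ : ∀ (z : ι → C) P, aeval z (ψ P) = aeval (fun i => c i + p * z i) P := by
    intro z P
    have h : (aeval z).comp ψ = aeval (fun i => c i + p * z i) :=
      algHom_ext fun i => by simp [ψ]
    exact DFunLike.congr_fun h P
  have hlin : ∀ i, ∃ w, ψ (Ψ (X i)) = ψ (X i) + MvPolynomial.C (p : C) ^ 2 * w := by
    intro i
    obtain ⟨a₀, a, w, h⟩ := exists_aeval_add_mul_eq (p : C) c (Ψ (X i))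
    have hz : ∀ z : ι → C, (p : C) ^ 2 ∣ (a₀ + p * ∑ j, a j * z j) - (c i + p * z i) := by
      intro z
      have h1 := hΨ ((Ideal.Quotient.mkₐ C _).comp (aeval fun i => c i + p * z i)) (X i)
      rw [AlgHom.comp_apply, AlgHom.comp_apply, ← hψ, Ideal.Quotient.mkₐ_eq_mk,
        Ideal.Quotient.eq, Ideal.mem_span_singleton] at h1
      simp only [ψ, h, aeval_X] at h1
      simp only [map_add, map_mul, map_sum, map_pow, aeval_C, aeval_X, Algebra.algebraMap_self,
        RingHom.id_apply] at h1
      rw [← dvd_add_left (dvd_mul_right ((p : C) ^ 2) (aeval z w))]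
      convert h1 using 1
      ring
    obtain ⟨r, hr⟩ := hz 0
    have hj : ∀ j, ∃ s, (p : C) * a j = (p : C) * (if j = i then 1 else 0) + (p : C) ^ 2 * s := by
      intro j
      obtain ⟨s, hs⟩ := hz (Pi.single j 1)
      refine ⟨s - r, ?_⟩
      simp [Pi.single_apply, eq_comm] at hs hr ⊢
      linear_combination hs - hr
    choose s hs using hj
    refine ⟨MvPolynomial.C r + ∑ j, MvPolynomial.C (s j) * X j + w, ?_⟩
    have h2 : MvPolynomial.C (p : C) * ∑ j, MvPolynomial.C (a j) * X j =
        MvPolynomial.C (p : C) * X i +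
          MvPolynomial.C (p : C) ^ 2 * ∑ j, MvPolynomial.C (s j) * X j := by
      simp only [Finset.mul_sum, ← mul_assoc, ← map_mul, hs, map_add, add_mul,
        Finset.sum_add_distrib]
      simp [apply_ite MvPolynomial.C, ite_mul]
    have h3 : MvPolynomial.C (σ := ι) a₀ =
        MvPolynomial.C (c i) + MvPolynomial.C (p : C) ^ 2 * MvPolynomial.C r := by
      rw [← map_pow, ← map_mul, ← map_add, ← hr]
      simp
    change aeval _ _ = _
    rw [h, h2, h3]
    simp only [ψ, aeval_X]
    ring
  choose w hw using hlin
  let τ : MvPolynomial ι C →ₐ[C] MvPolynomial ι C :=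
    aeval fun i => X i + MvPolynomial.C (p : C) * w i
  have hτψ : ∀ P, ψ (Ψ P) = τ (ψ P) := by
    have h : ψ.comp Ψ = τ.comp ψ := algHom_ext fun i => by
      rw [AlgHom.comp_apply, AlgHom.comp_apply, hw]
      simp only [ψ, τ, aeval_X, map_add, map_mul, algHom_C, algebraMap_eq]
      ring
    exact DFunLike.congr_fun h
  have hpow : ∀ n P, ψ ((Ψ ^ n) P) = (τ ^ n) (ψ P) := by
    intro n
    induction n with
    | zero => intro P; rfl
    | succ n ih => intro P; rw [pow_succ, pow_succ, AlgHom.mul_apply, AlgHom.mul_apply, ih, hτψ]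
  obtain ⟨u, hu⟩ := exists_iterate_eq_sum_choose (q := (p : C)) (τ := τ)
    (fun i => ⟨w i, by simp [τ]⟩) (ψ f)
  have hval : ∀ n, aeval c ((Ψ ^ n) f) = ∑ k ∈ Finset.range (n + 1),
      (n.choose k : ℤ_[p]) • ((p : ℤ_[p]) ^ k • aeval (0 : ι → C) (u k)) := by
    intro n
    have h1 := hψ 0 ((Ψ ^ n) f)
    rw [hpow, hu] at h1
    simp only [Pi.zero_apply, mul_zero, add_zero] at h1
    rw [← h1, map_sum]
    refine Finset.sum_congr rfl fun k _ => ?_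
    simp [Algebra.smul_def]
  simp only [hval]
  by_cases hfin : {n : ℕ | ∑ k ∈ Finset.range (n + 1),
      (n.choose k : ℤ_[p]) • ((p : ℤ_[p]) ^ k • aeval (0 : ι → C) (u k)) = 0}.Finite
  · exact Or.inl hfin
  · exact Or.inr fun n => newtonSeries_eq_zero_of_infinite_zeros_of_finite p hp _ hfin n

theorem finite_quotient_span_prime_pow (p : ℕ) [Fact p.Prime] [Algebra ℤ_[p] C]
    [Module.Finite ℤ_[p] C] (k : ℕ) : Finite (C ⧸ Ideal.span {(p : C) ^ k}) := by
  have h0 : Finite (ℤ_[p] ⧸ Ideal.span {(p : ℤ_[p]) ^ k}) := by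
    rw [← PadicInt.ker_toZModPow]
    have : NeZero (p ^ k) := ⟨pow_ne_zero _ (Fact.out : p.Prime).ne_zero⟩
    exact Finite.of_injective _ (RingHom.kerLift_injective (PadicInt.toZModPow k))
  have h1 : Ideal.span {(p : C) ^ k} =
      (Ideal.span {(p : ℤ_[p]) ^ k}).map (algebraMap ℤ_[p] C) := by
    simp [Ideal.map_span]
  rw [h1]
  have : Module.Finite (ℤ_[p] ⧸ Ideal.span {(p : ℤ_[p]) ^ k})
      (C ⧸ (Ideal.span {(p : ℤ_[p]) ^ k}).map (algebraMap ℤ_[p] C)) :=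
    Module.Finite.of_restrictScalars_finite ℤ_[p] _ _
  exact Module.finite_of_finite (ℤ_[p] ⧸ Ideal.span {(p : ℤ_[p]) ^ k})

theorem exists_period_finite_zeros_or_forall (p : ℕ) [Fact p.Prime] (hp : 3 ≤ p)
    [Algebra ℤ_[p] C] [Module.Finite ℤ_[p] C] [Module.IsTorsionFree ℤ_[p] C]
    {ι : Type*} [Fintype ι] (σ : MvPolynomial ι C ≃ₐ[C] MvPolynomial ι C) :
    ∃ N : ℕ, 0 < N ∧ ∀ (c : ι → C) (f : MvPolynomial ι C) (k : ℤ),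
      ({n : ℕ | aeval c ((σ ^ (k + N * n)) f) = 0}.Finite ∨
        ∀ n : ℕ, aeval c ((σ ^ (k + N * n)) f) = 0) ∧
      ({n : ℕ | aeval c ((σ ^ (k - N * n)) f) = 0}.Finite ∨
        ∀ n : ℕ, aeval c ((σ ^ (k - N * n)) f) = 0) := by
  have := finite_quotient_span_prime_pow (C := C) p 2
  obtain ⟨N, hN, h⟩ := exists_pow_comp_eq (S := C ⧸ Ideal.span {(p : C) ^ 2}) σ
  have key : ∀ φ : MvPolynomial ι C ≃ₐ[C] MvPolynomial ι C,
      (∀ (θ : MvPolynomial ι C →ₐ[C] C ⧸ Ideal.span {(p : C) ^ 2}) f, θ (φ f) = θ f) →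
      ∀ (c : ι → C) (f : MvPolynomial ι C), {n : ℕ | aeval c ((φ ^ n) f) = 0}.Finite ∨
        ∀ n : ℕ, aeval c ((φ ^ n) f) = 0 := by
    intro φ hφ c f
    have h1 : ∀ (n : ℕ) u, (φ ^ n) u = ((φ : MvPolynomial ι C →ₐ[C] MvPolynomial ι C) ^ n) u := by
      intro n
      induction n with
      | zero => intro u; rfl
      | succ n ih => intro u; rw [pow_succ, pow_succ, AlgEquiv.mul_apply, ih]; rfl
    simp only [h1]
    exact finite_zeros_or_eq_univ_of_quotient_comp_eq p hp _ hφ c f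
  refine ⟨N, hN, fun c f k => ⟨?_, ?_⟩⟩
  · have h1 : ∀ n : ℕ, (σ ^ (k + N * n)) f = ((σ ^ N) ^ n) ((σ ^ k) f) := by
      intro n
      rw [← AlgEquiv.mul_apply, ← pow_mul, ← zpow_natCast, ← zpow_add, add_comm]
      push_cast
      rfl
    simp only [h1]
    exact key _ h c _
  · have h1 : ∀ n : ℕ, (σ ^ (k - N * n)) f = (((σ ^ N)⁻¹) ^ n) ((σ ^ k) f) := by
      intro n
      rw [← AlgEquiv.mul_apply, inv_pow, ← pow_mul, ← zpow_natCast, ← zpow_neg, ← zpow_add,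
        add_comm, sub_eq_add_neg]
      push_cast
      rfl
    simp only [h1]
    refine key _ (fun θ f => ?_) c _
    rw [← h θ, ← AlgEquiv.mul_apply, mul_inv_cancel, AlgEquiv.one_apply]

end

theorem twoSidedSML_of_forall_residue {S : Set ℤ} {N : ℕ} (hN : 0 < N)
    (h : ∀ k : ℤ, ({n : ℕ | k + N * n ∈ S}.Finite ∨ ∀ n : ℕ, k + N * n ∈ S) ∧
      ({n : ℕ | k - N * n ∈ S}.Finite ∨ ∀ n : ℕ, k - N * n ∈ S)) : TwoSidedSML S := by
  classical
  have key : ∀ r : ℤ, {n : ℤ | N * n + r ∈ S}.Finite ∨ ∀ n : ℤ, N * n + r ∈ S := by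
    intro r
    by_cases h1 : {n : ℕ | r + N * n ∈ S}.Finite
    · by_cases h2 : {n : ℕ | r - N * n ∈ S}.Finite
      · left
        refine ((h1.image (fun n : ℕ => (n : ℤ))).union
          (h2.image (fun n : ℕ => -(n : ℤ)))).subset fun n hn => ?_
        obtain ⟨m, rfl | rfl⟩ := n.eq_nat_or_neg
        · exact Or.inl ⟨m, by simpa [add_comm] using hn, rfl⟩
        · refine Or.inr ⟨m, ?_, rfl⟩
          simpa [add_comm, sub_eq_add_neg] using hn
      · right
        intro n
        obtain ⟨h4, h5⟩ : 0 ≤ max n 0 ∧ n ≤ max n 0 := ⟨le_max_right _ _, le_max_left _ _⟩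
        obtain ⟨m, hm⟩ := Int.eq_ofNat_of_zero_le h4
        rw [hm] at h5
        have h3 := (h (r + N * m)).2.resolve_left fun hf => h2 <| by
          refine Set.Finite.of_finite_image (hf.subset ?_) (add_left_injective m).injOn
          rintro _ ⟨n, hn, rfl⟩
          have h6 : r + N * m - N * ((n + m : ℕ) : ℤ) = r - N * n := by push_cast; ring
          simpa only [Set.mem_ofPred_eq, h6] using hn
        obtain ⟨j, hj⟩ := Int.eq_ofNat_of_zero_le (by omega : (0 : ℤ) ≤ m - n)
        convert h3 j using 1
        obtain rfl : n = m - j := by omega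
        ring
    · right
      intro n
      obtain ⟨h4, h5⟩ : 0 ≤ max (-n) 0 ∧ -n ≤ max (-n) 0 := ⟨le_max_right _ _, le_max_left _ _⟩
      obtain ⟨m, hm⟩ := Int.eq_ofNat_of_zero_le h4
      rw [hm] at h5
      have h3 := (h (r - N * m)).1.resolve_left fun hf => h1 <| by
        refine Set.Finite.of_finite_image (hf.subset ?_) (add_left_injective m).injOn
        rintro _ ⟨n, hn, rfl⟩
        have h6 : r - N * m + N * ((n + m : ℕ) : ℤ) = r + N * n := by push_cast; ring
        simpa only [Set.mem_ofPred_eq, h6] using hn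
      obtain ⟨j, hj⟩ := Int.eq_ofNat_of_zero_le (by omega : (0 : ℤ) ≤ n + m)
      convert h3 j using 1
      obtain rfl : n = j - m := by omega
      ring
  let T := (Finset.range N).filter fun r : ℕ => ∀ n : ℤ, N * n + r ∈ S
  refine ⟨T.image fun r : ℕ => ((N : ℤ), (r : ℤ)),
    ⋃ r ∈ (Finset.range N).filter fun r : ℕ => ¬ ∀ n : ℤ, N * n + r ∈ S,
      (fun n : ℤ => N * n + r) '' {n : ℤ | N * n + r ∈ S}, ?_, ?_⟩
  · refine Set.Finite.biUnion (Finset.finite_toSet _) fun r hr => ?_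
    rw [Finset.mem_coe, Finset.mem_filter] at hr
    exact ((key r).resolve_right hr.2).image _
  · ext k
    simp only [Set.mem_union, Set.mem_iUnion, Finset.mem_image, Set.mem_ofPred_eq, exists_prop, T,
      Finset.mem_filter, Finset.mem_range, Set.mem_image]
    constructor
    · intro hk
      obtain ⟨r, hr⟩ := Int.eq_ofNat_of_zero_le (Int.emod_nonneg k (by omega : (N : ℤ) ≠ 0))
      have hrN : r < N := by
        have := Int.emod_lt_of_pos k (by omega : (0 : ℤ) < N)
        omega
      have hdiv : N * (k / N) + r = k := by rw [← hr]; exact Int.mul_ediv_add_emod k N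
      by_cases hall : ∀ n : ℤ, N * n + r ∈ S
      · exact Or.inl ⟨_, ⟨r, ⟨hrN, hall⟩, rfl⟩, k / N, hdiv.symm⟩
      · exact Or.inr ⟨r, ⟨hrN, hall⟩, k / N, by rwa [hdiv], hdiv⟩
    · rintro (⟨_, ⟨r, ⟨-, hr⟩, rfl⟩, n, rfl⟩ | ⟨r, -, n, hn, rfl⟩)
      · exact hr n
      · exact hn

theorem AlgebraicIndependent.exists_infinite_padic (p : ℕ) [Fact p.Prime] :
    ∃ s : Set ℚ_[p], s.Infinite ∧ AlgebraicIndependent ℚ ((↑) : s → ℚ_[p]) := by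
  obtain ⟨s, hs⟩ := exists_isTranscendenceBasis ℚ ℚ_[p]
  refine ⟨s, fun hfin => ?_, hs.1⟩
  have : Finite s := hfin
  have halg := hs.isAlgebraic
  have h1 := Algebra.IsAlgebraic.cardinalMk_le_max
    (Algebra.adjoin ℚ (Set.range ((↑) : s → ℚ_[p]))) ℚ_[p]
  have h2 : Cardinal.mk (Algebra.adjoin ℚ (Set.range ((↑) : s → ℚ_[p]))) ≤ Cardinal.aleph0 := by
    rw [← Cardinal.mk_congr hs.1.aevalEquiv.toEquiv]
    refine MvPolynomial.cardinalMk_le_max.trans ?_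
    simp
  have h3 := continuum_le_cardinal_of_nontriviallyNormedField ℚ_[p]
  exact (h3.trans (h1.trans (max_le h2 le_rfl))).not_gt Cardinal.aleph0_lt_continuum

theorem AlgebraicIndependent.add_smul {ι k A : Type*} [Field k] [CommRing A] [Algebra k A]
    {x : ι → A} (hx : AlgebraicIndependent k x) (a q : ι → k) (hq : ∀ i, q i ≠ 0) :
    AlgebraicIndependent k fun i => algebraMap k A (a i) + q i • x i := by
  let φ : MvPolynomial ι k →ₐ[k] MvPolynomial ι k :=
    MvPolynomial.aeval fun i => MvPolynomial.C (a i) + MvPolynomial.C (q i) * MvPolynomial.X i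
  let φ' : MvPolynomial ι k →ₐ[k] MvPolynomial ι k :=
    MvPolynomial.aeval fun i => MvPolynomial.C (q i)⁻¹ * (MvPolynomial.X i - MvPolynomial.C (a i))
  have h1 : φ'.comp φ = AlgHom.id k _ := MvPolynomial.algHom_ext fun i => by
    simp only [AlgHom.comp_apply, φ, φ', MvPolynomial.aeval_X, map_add, map_mul,
      MvPolynomial.algHom_C, MvPolynomial.algebraMap_eq, AlgHom.id_apply]
    rw [← mul_assoc, ← map_mul, mul_inv_cancel₀ (hq i)]
    simp
  have h2 : MvPolynomial.aeval (fun i => algebraMap k A (a i) + q i • x i) =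
      (MvPolynomial.aeval x).comp φ := MvPolynomial.algHom_ext fun i => by
    simp [φ, Algebra.smul_def]
  rw [AlgebraicIndependent, h2, AlgHom.coe_comp]
  exact Function.Injective.comp hx
    (Function.LeftInverse.injective (g := φ') fun u => DFunLike.congr_fun h1 u)

theorem exists_algebraicIndependent_padicInt (p : ℕ) [Fact p.Prime] {ι : Type*} [Finite ι]
    (a₀ : ι → ℤ) : ∃ a : ι → ℤ_[p], (∀ i, ∃ z, a i = a₀ i + p * z) ∧
      AlgebraicIndependent ℤ fun i => (a i : ℚ_[p]) := by
  obtain ⟨s, hs, hind⟩ := AlgebraicIndependent.exists_infinite_padic p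
  have : Infinite s := hs.to_subtype
  let e : ι ↪ s := (Finite.equivFin ι).toEmbedding.trans
    (Fin.valEmbedding.trans (Infinite.natEmbedding s))
  have hp0 : (p : ℚ) ≠ 0 := by exact_mod_cast (Fact.out : p.Prime).ne_zero
  have hscale : ∀ x : ℚ_[p], ∃ k : ℕ, ∃ z : ℤ_[p], (p : ℚ_[p]) ^ k * x = z := by
    intro x
    obtain ⟨k, hk⟩ := pow_unbounded_of_one_lt ‖x‖
      (by exact_mod_cast (Fact.out : p.Prime).one_lt : (1 : ℝ) < p)
    refine ⟨k, ⟨(p : ℚ_[p]) ^ k * x, ?_⟩, rfl⟩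
    have hp1 : (0 : ℝ) < p := by exact_mod_cast (Fact.out : p.Prime).pos
    rw [norm_mul, norm_pow, Padic.norm_p, inv_pow, inv_mul_le_iff₀ (by positivity), mul_one]
    exact hk.le
  choose k z hz using fun i => hscale (e i : ℚ_[p])
  refine ⟨fun i => a₀ i + p * z i, fun i => ⟨z i, rfl⟩, ?_⟩
  have h := (hind.comp e e.injective).add_smul (fun i => (a₀ i : ℚ)) (fun i => (p : ℚ) ^ (k i + 1))
    fun i => pow_ne_zero _ hp0
  convert h.restrictScalars (R := ℤ) (algebraMap ℤ ℚ).injective_int using 2 with i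
  push_cast
  rw [← hz, Algebra.smul_def]
  simp
  ring

theorem exists_prime_isUnit_aeval {ι : Type*} [Finite ι] {h : MvPolynomial ι ℤ} (hh : h ≠ 0) :
    ∃ (p : ℕ) (_ : Fact p.Prime), 3 ≤ p ∧ ∃ a : ι → ℤ_[p],
      AlgebraicIndependent ℤ (fun i => (a i : ℚ_[p])) ∧ IsUnit (MvPolynomial.aeval a h) := by
  obtain ⟨a₀, ha₀⟩ : ∃ a₀ : ι → ℤ, MvPolynomial.eval a₀ h ≠ 0 := by
    by_contra! hcon
    exact hh (MvPolynomial.funext fun x => by rw [hcon, map_zero])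
  obtain ⟨p, hp, hprime⟩ := Nat.exists_infinite_primes
    (max 3 ((MvPolynomial.eval a₀ h).natAbs + 1))
  have : Fact p.Prime := ⟨hprime⟩
  obtain ⟨a, ha, hind⟩ := exists_algebraicIndependent_padicInt p a₀
  refine ⟨p, this, (le_max_left _ _).trans hp, a, hind, ?_⟩
  let π := Ideal.Quotient.mkₐ ℤ (Ideal.span {(p : ℤ_[p])})
  have hcongr : π.comp (MvPolynomial.aeval a) =
      (π.comp (Algebra.ofId ℤ ℤ_[p])).comp (MvPolynomial.aeval a₀) :=
    MvPolynomial.algHom_ext fun i => by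
      obtain ⟨z, hz⟩ := ha i
      simp only [AlgHom.comp_apply, MvPolynomial.aeval_X, π, Ideal.Quotient.mkₐ_eq_mk,
        Ideal.Quotient.eq, Ideal.mem_span_singleton]
      exact ⟨z, by rw [hz, Algebra.ofId_apply, eq_intCast]; ring⟩
  have h1 : (p : ℤ_[p]) ∣ MvPolynomial.aeval a h - ((MvPolynomial.eval a₀ h : ℤ) : ℤ_[p]) := by
    rw [← Ideal.mem_span_singleton, ← Ideal.Quotient.eq]
    exact DFunLike.congr_fun hcongr h
  have hmem : ∀ z : ℤ_[p], ‖z‖ < 1 ↔ (p : ℤ_[p]) ∣ z := fun z =>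
    PadicInt.norm_lt_one_iff_dvd z
  rw [PadicInt.isUnit_iff]
  refine le_antisymm (PadicInt.norm_le_one _) (not_lt.mp fun hlt => ?_)
  have h2 := (dvd_sub_right ((hmem _).mp hlt)).mp h1
  rw [← hmem, PadicInt.norm_int_lt_one_iff_dvd] at h2
  have h3 := Nat.le_of_dvd (Int.natAbs_pos.mpr ha₀) (Int.natCast_dvd.mp h2)
  have h4 := (le_max_right _ _).trans hp
  omega

/-- Lech's embedding theorem, with values in the algebraic closure of a `p`-adic field. -/
theorem exists_injective_ringHom_algebraicClosure_padic {R : Type*} [CommRing R] [IsDomain R]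
    [CharZero R] {s : Set R} (hs : s.Finite) (hadj : Algebra.adjoin ℤ s = ⊤) :
    ∃ (p : ℕ) (_ : Fact p.Prime), 3 ≤ p ∧ ∃ φ : R →+* AlgebraicClosure ℚ_[p],
      Function.Injective φ ∧ ∀ r ∈ s, IsIntegral ℤ_[p] (φ r) := by
  have halg : Algebra.IsAlgebraic (Algebra.adjoin ℤ s) R :=
    ⟨fun r => isAlgebraic_algebraMap
      (⟨r, hadj ▸ Algebra.mem_top⟩ : Algebra.adjoin ℤ s)⟩
  obtain ⟨t, hts, ht⟩ := exists_isTranscendenceBasis_subset (R := ℤ) s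
  have : Finite t := hs.subset hts
  have halgt := ht.isAlgebraic
  set S := Algebra.adjoin ℤ (Set.range ((↑) : t → R)) with hS
  obtain ⟨y, hy0, hy⟩ := Algebra.IsAlgebraic.exists_integral_multiples S hs.toFinset
  let e := ht.1.aevalEquiv
  obtain ⟨p, hp, hp3, a, hind, hunit⟩ :=
    exists_prime_isUnit_aeval (h := e.symm y) (by simpa using hy0)
  refine ⟨p, hp, hp3, ?_⟩
  let j₀ : S →+* ℤ_[p] := (MvPolynomial.aeval a).toRingHom.comp e.symm.toRingEquiv.toRingHom
  have hj₀ : Function.Injective j₀ := by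
    have h1 : AlgebraicIndependent ℤ a :=
      AlgebraicIndependent.of_comp PadicInt.Coe.ringHom.toIntAlgHom hind
    have h2 : ∀ x, j₀ x = MvPolynomial.aeval a (e.symm x) := fun _ => rfl
    intro x y hxy
    rw [h2, h2] at hxy
    exact e.symm.injective (h1 hxy)
  let _ : Algebra S ℤ_[p] := j₀.toAlgebra
  let _ : Algebra S (AlgebraicClosure ℚ_[p]) :=
    ((algebraMap ℤ_[p] (AlgebraicClosure ℚ_[p])).comp j₀).toAlgebra
  have : IsScalarTower S ℤ_[p] (AlgebraicClosure ℚ_[p]) :=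
    IsScalarTower.of_algebraMap_eq fun _ => rfl
  have hinjΩ : Function.Injective (algebraMap ℤ_[p] (AlgebraicClosure ℚ_[p])) := by
    rw [IsScalarTower.algebraMap_eq ℤ_[p] ℚ_[p]]
    exact (algebraMap ℚ_[p] _).injective.comp (IsFractionRing.injective ℤ_[p] ℚ_[p])
  have hinjS : Function.Injective (algebraMap S (AlgebraicClosure ℚ_[p])) := hinjΩ.comp hj₀
  have : Module.IsTorsionFree S (AlgebraicClosure ℚ_[p]) :=
    Module.isTorsionFree_iff_algebraMap_injective.mpr hinjS
  let φ : R →ₐ[S] AlgebraicClosure ℚ_[p] := IsAlgClosed.lift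
  refine ⟨φ, ?_, fun r hr => ?_⟩
  · refine (injective_iff_map_eq_zero _).mpr fun r hr => by_contra fun hr0 => ?_
    obtain ⟨z, hz0, w, hw⟩ :=
      (halgt.isAlgebraic r).exists_nonzero_dvd (mem_nonZeroDivisors_of_ne_zero hr0)
    have h1 := φ.commutes z
    rw [hw, map_mul] at h1
    change φ r = 0 at hr
    rw [hr, zero_mul] at h1
    exact hz0 (hinjS (by rw [← h1, map_zero]))
  · have h1 : IsIntegral ℤ_[p] (φ (y • r)) :=
      ((hy r (by simpa using hr)).map φ).tower_top
    rw [map_smul, ← algebraMap_smul ℤ_[p] y (φ r)] at h1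
    obtain ⟨u, hu⟩ : IsUnit (algebraMap S ℤ_[p] y) := hunit
    have h2 := h1.smul (↑u⁻¹ : ℤ_[p])
    rwa [← hu, smul_smul, Units.inv_mul, one_smul] at h2

universe u in
/-- A finitely generated subring of a finite-dimensional commutative algebra over a field of
characteristic zero embeds into a finite free algebra over some ring of `ℓ`-adic integers. -/
theorem exists_injective_ringHom_finite_padicInt {K : Type*} {B : Type u} [Field K] [CharZero K]
    [CommRing B] [Algebra K B] [FiniteDimensional K B] {s : Set B} (hs : s.Finite) :
    ∃ (p : ℕ) (_ : Fact p.Prime), 3 ≤ p ∧ ∃ (C : Type u) (_ : CommRing C) (_ : Algebra ℤ_[p] C),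
      Module.Finite ℤ_[p] C ∧ Module.IsTorsionFree ℤ_[p] C ∧
        ∃ j : Algebra.adjoin ℤ s →+* C, Function.Injective j := by
  classical
  let b := Module.finBasis K B
  let n := Fin (Module.finrank K B)
  let m : B →ₐ[K] Matrix n n K := Algebra.leftMulMatrix b
  have hm : Function.Injective m := Algebra.leftMulMatrix_injective b
  let E : Set K := ⋃ x ∈ s, Set.range fun ij : _ × _ => m x ij.1 ij.2
  have hE : E.Finite := hs.biUnion fun x _ => Set.finite_range _
  let R := Algebra.adjoin ℤ E
  have hadj : Algebra.adjoin ℤ ((↑) ⁻¹' E : Set R) = ⊤ := Algebra.adjoin_adjoin_coe_preimage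
  obtain ⟨p, hp, hp3, φ, hφ, hint⟩ := exists_injective_ringHom_algebraicClosure_padic
    (hE.preimage Subtype.val_injective.injOn) hadj
  refine ⟨p, hp, hp3, ?_⟩
  let O := Algebra.adjoin ℤ_[p] (φ '' ((↑) ⁻¹' E))
  have hO : Module.Finite ℤ_[p] O := by
    refine Module.Finite.iff_fg.mpr
      (fg_adjoin_of_finite ((hE.preimage Subtype.val_injective.injOn).image _) ?_)
    rintro _ ⟨r, hr, rfl⟩
    exact hint r hr
  have hφO : ∀ r, φ r ∈ O := by
    intro r
    have : r ∈ (O.restrictScalars ℤ).comap φ.toIntAlgHom := by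
      refine (hadj ▸ Algebra.adjoin_le ?_ : (⊤ : Subalgebra ℤ R) ≤ _) Algebra.mem_top
      intro x hx
      exact Algebra.subset_adjoin ⟨x, hx, rfl⟩
    exact this
  let φ' : R →+* O := φ.codRestrict O hφO
  have hφ' : Function.Injective φ' := fun x y h => hφ (congrArg Subtype.val h)
  let ιR : Matrix n n R →ₐ[ℤ] Matrix n n K := R.val.mapMatrix
  let M : Algebra.adjoin ℤ s →ₐ[ℤ] Matrix n n K :=
    (m.restrictScalars ℤ).comp (Algebra.adjoin ℤ s).val
  have hιR : Function.Injective ιR := fun x y h =>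
    Matrix.ext fun i k => Subtype.ext (congrFun (congrFun h i) k)
  have hM : ∀ x, M x ∈ ιR.range := by
    rintro ⟨x, hx⟩
    refine Algebra.adjoin_le (S := ιR.range.comap (m.restrictScalars ℤ)) (fun y hy => ?_) hx
    have hy' : ∀ i k, m y i k ∈ R := fun i k =>
      Algebra.subset_adjoin (Set.mem_biUnion hy ⟨(i, k), rfl⟩)
    exact ⟨Matrix.of fun i k => ⟨m y i k, hy' i k⟩, rfl⟩
  have hMinj : Function.Injective M := hm.comp Subtype.val_injective
  let j₁ : Algebra.adjoin ℤ s →ₐ[ℤ] Matrix n n R :=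
    ((AlgEquiv.ofInjective ιR hιR).symm : _ →ₐ[ℤ] _).comp (M.codRestrict ιR.range hM)
  have hj₁ : Function.Injective j₁ := fun x y h =>
    hMinj (congrArg Subtype.val ((AlgEquiv.ofInjective ιR hιR).symm.injective h))
  let j₂ : Algebra.adjoin ℤ s →ₐ[ℤ] Matrix n n O :=
    φ'.toIntAlgHom.mapMatrix.comp j₁
  have hj₂ : Function.Injective j₂ := fun x y h =>
    hj₁ (Matrix.ext fun i k => hφ' (congrFun (congrFun h i) k))
  let Λ : ℤ_[p] ⊗[ℤ] Algebra.adjoin ℤ s →ₐ[ℤ_[p]] Matrix n n O :=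
    Algebra.TensorProduct.lift (Algebra.ofId _ _) j₂ fun x y => Algebra.commutes _ _
  have hnoeth : IsNoetherian ℤ_[p] (n → n → O) := inferInstance
  have hnoeth' : IsNoetherian ℤ_[p] (Matrix n n O) := hnoeth
  have hinjΩ : Function.Injective (algebraMap ℤ_[p] (AlgebraicClosure ℚ_[p])) := by
    rw [IsScalarTower.algebraMap_eq ℤ_[p] ℚ_[p]]
    exact (algebraMap ℚ_[p] _).injective.comp (IsFractionRing.injective ℤ_[p] ℚ_[p])
  have htfΩ : Module.IsTorsionFree ℤ_[p] (AlgebraicClosure ℚ_[p]) :=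
    Module.isTorsionFree_iff_algebraMap_injective.mpr hinjΩ
  have htfO : Module.IsTorsionFree ℤ_[p] O :=
    Function.Injective.moduleIsTorsionFree O.val Subtype.val_injective fun c x => rfl
  have htf : Module.IsTorsionFree ℤ_[p] (n → n → O) := inferInstance
  have htf' : Module.IsTorsionFree ℤ_[p] (Matrix n n O) := htf
  refine ⟨_ ⧸ RingHom.ker Λ, inferInstance, inferInstance, ?_, ?_, ?_⟩
  · exact Module.Finite.of_injective (Ideal.kerLiftAlg Λ).toLinearMap
      (RingHom.kerLift_injective Λ.toRingHom)
  · exact Function.Injective.moduleIsTorsionFree (Ideal.kerLiftAlg Λ)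
      (RingHom.kerLift_injective Λ.toRingHom)
      fun c x => (Ideal.kerLiftAlg Λ).toLinearMap.map_smul c x
  · have hΛ : ∀ x, Λ (1 ⊗ₜ x) = j₂ x := fun x =>
      (Algebra.TensorProduct.lift_tmul _ _ _ _ _).trans (by rw [map_one, one_mul])
    refine ⟨(Ideal.Quotient.mk _).comp (Algebra.TensorProduct.includeRight :
      Algebra.adjoin ℤ s →ₐ[ℤ] ℤ_[p] ⊗[ℤ] Algebra.adjoin ℤ s).toRingHom, fun x y h => hj₂ ?_⟩
    have h1 : Λ (1 ⊗ₜ x) = Λ (1 ⊗ₜ y) := congrArg (Ideal.kerLiftAlg Λ) h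
    rwa [hΛ, hΛ] at h1

namespace MvPolynomial

variable {ι R A : Type*} [CommRing R] [CommRing A]

theorem exists_algEquiv_X_eq {g h : ι → MvPolynomial ι R} (hgh : ∀ i, bind₁ g (h i) = X i)
    (hhg : ∀ i, bind₁ h (g i) = X i) :
    ∃ σ : MvPolynomial ι R ≃ₐ[R] MvPolynomial ι R, ∀ i, σ (X i) = g i :=
  ⟨AlgEquiv.ofAlgHom (bind₁ g) (bind₁ h) (algHom_ext fun i => by simp [hgh])
    (algHom_ext fun i => by simp [hhg]), fun i => by simp⟩

theorem bind₁_algEquiv_X (σ : MvPolynomial ι R ≃ₐ[R] MvPolynomial ι R) (f : MvPolynomial ι R) :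
    bind₁ (fun i => σ (X i)) f = σ f :=
  DFunLike.congr_fun (algHom_ext (f := bind₁ fun i => σ (X i)) (g := σ.toAlgHom)
    fun i => by simp) f

theorem exists_algEquiv_map_X_eq (θ : R →+* A) (σ : MvPolynomial ι R ≃ₐ[R] MvPolynomial ι R) :
    ∃ σ' : MvPolynomial ι A ≃ₐ[A] MvPolynomial ι A, ∀ i, map θ (σ (X i)) = σ' (X i) := by
  obtain ⟨σ', h⟩ := exists_algEquiv_X_eq (g := fun i => map θ (σ (X i)))
    (h := fun i => map θ (σ.symm (X i)))
    (fun i => by rw [← map_bind₁, bind₁_algEquiv_X, AlgEquiv.apply_symm_apply, map_X])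
    (fun i => by rw [← map_bind₁, bind₁_algEquiv_X, AlgEquiv.symm_apply_apply, map_X])
  exact ⟨σ', fun i => (h i).symm⟩

theorem exists_algEquiv_map_X_eq_of_mem_range {θ : R →+* A} (hθ : Function.Injective θ)
    (σ : MvPolynomial ι A ≃ₐ[A] MvPolynomial ι A) (h : ∀ i, σ (X i) ∈ (map (σ := ι) θ).range)
    (h' : ∀ i, σ.symm (X i) ∈ (map (σ := ι) θ).range) :
    ∃ σ' : MvPolynomial ι R ≃ₐ[R] MvPolynomial ι R, ∀ i, map θ (σ' (X i)) = σ (X i) := by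
  choose u hu using h
  choose v hv using h'
  obtain ⟨σ', hσ'⟩ := exists_algEquiv_X_eq (g := u) (h := v)
    (fun i => map_injective θ hθ (by
      rw [map_bind₁, hv, _root_.funext hu, bind₁_algEquiv_X, AlgEquiv.apply_symm_apply, map_X]))
    (fun i => map_injective θ hθ (by
      rw [map_bind₁, hu, _root_.funext hv, bind₁_algEquiv_X, AlgEquiv.symm_apply_apply, map_X]))
  exact ⟨σ', fun i => by rw [hσ', hu]⟩

theorem map_algEquiv_apply {θ : R →+* A} {σ : MvPolynomial ι R ≃ₐ[R] MvPolynomial ι R}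
    {σ' : MvPolynomial ι A ≃ₐ[A] MvPolynomial ι A} (h : ∀ i, map θ (σ (X i)) = σ' (X i))
    (f : MvPolynomial ι R) : map θ (σ f) = σ' (map θ f) := by
  rw [← bind₁_algEquiv_X, map_bind₁, _root_.funext h, bind₁_algEquiv_X]

theorem map_algEquiv_zpow_apply {θ : R →+* A} {σ : MvPolynomial ι R ≃ₐ[R] MvPolynomial ι R}
    {σ' : MvPolynomial ι A ≃ₐ[A] MvPolynomial ι A} (h : ∀ i, map θ (σ (X i)) = σ' (X i))
    (n : ℤ) (f : MvPolynomial ι R) : map θ ((σ ^ n) f) = (σ' ^ n) (map θ f) := by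
  induction n generalizing f with
  | zero => simp
  | succ n ih => rw [zpow_add_one, zpow_add_one, AlgEquiv.mul_apply, AlgEquiv.mul_apply, ih,
      map_algEquiv_apply h]
  | pred n ih =>
    rw [zpow_sub_one, zpow_sub_one, AlgEquiv.mul_apply, AlgEquiv.mul_apply, ih]
    congr 1
    apply σ'.injective
    rw [← map_algEquiv_apply h, ← AlgEquiv.mul_apply, ← AlgEquiv.mul_apply, mul_inv_cancel,
      mul_inv_cancel, AlgEquiv.one_apply, AlgEquiv.one_apply]

end MvPolynomial

open MvPolynomial in
theorem twoSidedSML_setOf_aeval_zpow_eq_zero {K A B ι : Type*} [Field K] [CharZero K] [CommRing A]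
    [CommRing B] [Algebra K B] [FiniteDimensional K B] [Algebra A B] [Fintype ι]
    (σ : MvPolynomial ι A ≃ₐ[A] MvPolynomial ι A) (b : ι → B) (G : Finset (MvPolynomial ι A)) :
    TwoSidedSML {n : ℤ | ∀ f ∈ G, aeval b ((σ ^ n) f) = 0} := by
  obtain ⟨σB, hσB⟩ := exists_algEquiv_map_X_eq (algebraMap A B) σ
  let s : Set B := Set.range b ∪ (⋃ i, ((σB (X i)).coeffs : Set B)) ∪
    (⋃ i, ((σB.symm (X i)).coeffs : Set B)) ∪
    ⋃ f ∈ G, ((map (algebraMap A B) f).coeffs : Set B)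
  have hs : s.Finite := by
    refine (((Set.finite_range b).union (Set.finite_iUnion fun i => Finset.finite_toSet _)).union
      (Set.finite_iUnion fun i => Finset.finite_toSet _)).union
      (G.finite_toSet.biUnion fun f _ => Finset.finite_toSet _)
  obtain ⟨ℓ, hℓ, hℓ3, C, _, _, _, _, j, hj⟩ := exists_injective_ringHom_finite_padicInt (K := K) hs
  let R := Algebra.adjoin ℤ s
  let θ : R →+* B := R.val.toRingHom
  have hθ : Function.Injective θ := Subtype.val_injective
  have hmem : ∀ x ∈ s, x ∈ Set.range θ := fun x hx => ⟨⟨x, Algebra.subset_adjoin hx⟩, rfl⟩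
  have hrange : ∀ f : MvPolynomial ι B, (f.coeffs : Set B) ⊆ s → f ∈ (map (σ := ι) θ).range :=
    fun f hf => mem_range_map_iff_coeffs_subset.mpr fun x hx => hmem x (hf hx)
  obtain ⟨σR, hσR⟩ := exists_algEquiv_map_X_eq_of_mem_range hθ σB
    (fun i => hrange _ fun x hx => Or.inl (Or.inl (Or.inr (Set.mem_iUnion_of_mem i hx))))
    (fun i => hrange _ fun x hx => Or.inl (Or.inr (Set.mem_iUnion_of_mem i hx)))
  obtain ⟨σC, hσC⟩ := exists_algEquiv_map_X_eq j σR
  choose bR hbR using fun i => hmem (b i) (Or.inl (Or.inl (Or.inl ⟨i, rfl⟩)))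
  have hG : ∀ f : G, ∃ u, map θ u = map (algebraMap A B) f.1 := fun f =>
    hrange _ fun x hx => Or.inr (Set.mem_biUnion f.2 hx)
  choose u hu using hG
  have key : ∀ (f : G) (n : ℤ), aeval b ((σ ^ n) f.1) = 0 ↔
      aeval (fun i => j (bR i)) ((σC ^ n) (map j (u f))) = 0 := fun f n => by
    have h1 : aeval b ((σ ^ n) f.1) = θ (eval bR ((σR ^ n) (u f))) := by
      rw [aeval_def, ← eval_map, map_algEquiv_zpow_apply hσB, ← hu, ← map_algEquiv_zpow_apply hσR,
        map_eval, ← _root_.funext hbR]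
      rfl
    have h2 : aeval (fun i => j (bR i)) ((σC ^ n) (map j (u f))) =
        j (eval bR ((σR ^ n) (u f))) := by
      rw [← map_algEquiv_zpow_apply hσC, map_eval]
      rfl
    rw [h1, h2, map_eq_zero_iff θ hθ, map_eq_zero_iff j hj]
  obtain ⟨N, hN, h⟩ := exists_period_finite_zeros_or_forall ℓ hℓ3 σC
  have inter : ∀ e : ℕ → ℤ, (∀ f : G, {n : ℕ | aeval b ((σ ^ e n) f.1) = 0}.Finite ∨
      ∀ n : ℕ, aeval b ((σ ^ e n) f.1) = 0) →
      {n : ℕ | ∀ f ∈ G, aeval b ((σ ^ e n) f) = 0}.Finite ∨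
        ∀ n : ℕ, ∀ f ∈ G, aeval b ((σ ^ e n) f) = 0 := fun e he => by
    by_cases hall : ∀ f : G, ∀ n : ℕ, aeval b ((σ ^ e n) f.1) = 0
    · exact Or.inr fun n f hf => hall ⟨f, hf⟩ n
    · push Not at hall
      obtain ⟨f, n, hn⟩ := hall
      exact Or.inl (((he f).resolve_right fun h => hn (h n)).subset fun n hn => hn f.1 f.2)
  refine twoSidedSML_of_forall_residue hN fun k => ⟨inter _ fun f => ?_, inter _ fun f => ?_⟩
  · simpa only [key] using (h _ (map j (u f)) k).1
  · simpa only [key] using (h _ (map j (u f)) k).2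

theorem PReduced.isTorsionFree_quotient {p : ℕ} [Fact p.Prime] {A : Type*} [CommRing A]
    [Algebra ℤ_[p] A] {I : Ideal A} (hI : PReduced p I) : Module.IsTorsionFree ℤ_[p] (A ⧸ I) := by
  have hpow : ∀ (n : ℕ) (x : A), (p : A) ^ n * x ∈ I → x ∈ I := fun n => by
    induction n with
    | zero => simp
    | succ n ih => exact fun x hx => ih x (hI.2 _ (by rwa [← mul_assoc, ← pow_succ']))
  refine Module.isTorsionFree_iff_smul_eq_zero.mpr ?_
  intro r x hrx
  by_cases hr : r = 0
  · exact Or.inl hr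
  obtain ⟨x, rfl⟩ := Ideal.Quotient.mk_surjective x
  right
  rw [PadicInt.unitCoeff_spec hr, mul_smul, ← Units.smul_def] at hrx
  have h1 := (smul_eq_zero_iff_eq (PadicInt.unitCoeff hr)).mp hrx
  refine Ideal.Quotient.eq_zero_iff_mem.mpr (hpow (r.valuation) x ?_)
  rw [← Ideal.Quotient.eq_zero_iff_mem, map_mul, ← h1, Algebra.smul_def]
  simp

/-- **Proposition 4.3.** Let `p ≥ 5` be prime and `I`, `J` two `p`-reduced
ideals in `ℤ_p[x₁, …, x_d]` such that `(ℤ_p[x₁, …, x_d]/I) ⊗_{ℤ_p} ℚ_p` is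
finite-dimensional over `ℚ_p`. If `σ` is a `ℤ_p`-algebra automorphism of
`ℤ_p[x₁, …, x_d]`, then `{n ∈ ℤ : σⁿ(I) ⊇ J}` has the two-sided SML property. -/
theorem stmt14 (p : ℕ) [Fact p.Prime] (hp : 5 ≤ p) (d : ℕ)
    (I J : Ideal (MvPolynomial (Fin d) ℤ_[p]))
    (hI : PReduced p I) (hJ : PReduced p J)
    (hfd : FiniteDimensional ℚ_[p] (ℚ_[p] ⊗[ℤ_[p]] (MvPolynomial (Fin d) ℤ_[p] ⧸ I)))
    (σ : MvPolynomial (Fin d) ℤ_[p] ≃ₐ[ℤ_[p]] MvPolynomial (Fin d) ℤ_[p]) :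
    TwoSidedSML {n : ℤ |
      J ≤ I.map (σ ^ n : MvPolynomial (Fin d) ℤ_[p] ≃ₐ[ℤ_[p]] MvPolynomial (Fin d) ℤ_[p])} := by
  classical
  have htf := hI.isTorsionFree_quotient
  have hflat : Module.Flat ℤ_[p] (MvPolynomial (Fin d) ℤ_[p] ⧸ I) := inferInstance
  let β : (MvPolynomial (Fin d) ℤ_[p] ⧸ I) →ₐ[ℤ_[p]]
      ℚ_[p] ⊗[ℤ_[p]] (MvPolynomial (Fin d) ℤ_[p] ⧸ I) := Algebra.TensorProduct.includeRight
  have hβ : Function.Injective β := Algebra.TensorProduct.includeRight_injective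
    (IsFractionRing.injective ℤ_[p] ℚ_[p])
  let b : Fin d → ℚ_[p] ⊗[ℤ_[p]] (MvPolynomial (Fin d) ℤ_[p] ⧸ I) :=
    fun i => β (Ideal.Quotient.mkₐ ℤ_[p] I (MvPolynomial.X i))
  have hb : ∀ f, MvPolynomial.aeval b f = 0 ↔ f ∈ I := fun f => by
    have h1 : MvPolynomial.aeval b = β.comp (Ideal.Quotient.mkₐ ℤ_[p] I) :=
      MvPolynomial.algHom_ext fun i => by simp [b]
    rw [h1, AlgHom.comp_apply, map_eq_zero_iff β hβ]
    exact Ideal.Quotient.eq_zero_iff_mem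
  obtain ⟨G, hG⟩ := IsNoetherian.noetherian J
  convert twoSidedSML_setOf_aeval_zpow_eq_zero (K := ℚ_[p]) σ⁻¹ b G using 1
  ext n
  simp only [Set.mem_ofPred_eq, hb]
  rw [← hG, Submodule.span_le]
  refine forall₂_congr fun f _ => ?_
  rw [inv_zpow, SetLike.mem_coe]
  constructor
  · intro h
    obtain ⟨g, hg, rfl⟩ := (Ideal.mem_map_iff_of_surjective _ (σ ^ n).surjective).mp h
    rwa [← AlgEquiv.mul_apply, inv_mul_cancel]
  · intro h
    convert Ideal.mem_map_of_mem (σ ^ n) h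
    rw [← AlgEquiv.mul_apply, mul_inv_cancel, AlgEquiv.one_apply]
end

section
/- Let K be an uncountable field and let A be a finitely generated commutative K-algebra. Suppose that there exists a countable set {I_i : i ≥ 1} of ideals of A such that every ideal L of A of finite codimension (i.e., with A/L finite-dimensional as a K-vector space) contains some I_i. Then there exist finitely many indices j₁, …, j_d such that I_{j₁} ∩ ⋯ ∩ I_{j_d} = (0). -/
open scoped nonZeroDivisors

/-- Over an uncountable field, countably many nonzero polynomials have a common non-root. -/
theorem MvPolynomial.exists_forall_eval_ne_zero_of_countable {K ι : Type*} [Field K] [Uncountable K]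
    [Countable ι] (n : ℕ) (p : ι → MvPolynomial (Fin n) K) (hp : ∀ i, p i ≠ 0) :
    ∃ x : Fin n → K, ∀ i, MvPolynomial.eval x (p i) ≠ 0 := by
  induction n with
  | zero =>
    refine ⟨Fin.elim0, fun i h ↦ hp i ?_⟩
    rw [MvPolynomial.eq_C_of_isEmpty (p i)] at h ⊢
    rw [MvPolynomial.eval_C] at h
    rw [h, map_zero]
  | succ n ih =>
    obtain ⟨x, hx⟩ := ih (fun i ↦ (MvPolynomial.finSuccEquiv K n (p i)).leadingCoeff)
      (fun i ↦ by simpa using hp i)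
    let q (i : ι) : Polynomial K :=
      (MvPolynomial.finSuccEquiv K n (p i)).map (MvPolynomial.eval x)
    have hq (i : ι) : q i ≠ 0 := fun h ↦ hx i <| by
      simpa [q, Polynomial.coeff_map] using
        congrArg (Polynomial.coeff · (MvPolynomial.finSuccEquiv K n (p i)).natDegree) h
    have hc : (⋃ i, {y | (q i).IsRoot y}).Countable :=
      Set.countable_iUnion fun i ↦ (Polynomial.finite_setOfPred_isRoot (hq i)).countable
    obtain ⟨y, hy⟩ : ∃ y, y ∉ ⋃ i, {y | (q i).IsRoot y} := by
      by_contra! h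
      exact Set.not_countable_univ (hc.mono fun y _ ↦ h y)
    refine ⟨Fin.cons y x, fun i h ↦ hy (Set.mem_iUnion.2 ⟨i, ?_⟩)⟩
    rwa [MvPolynomial.eval_eq_eval_mv_eval'] at h

/-- Finitely generated torsion-free modules over a domain are torsionless. -/
theorem Module.exists_dual_apply_ne_zero_of_isTorsionFree {R M : Type*} [CommRing R] [IsDomain R]
    [AddCommGroup M] [Module R M] [Module.Finite R M] [Module.IsTorsionFree R M]
    {a : M} (ha : a ≠ 0) : ∃ φ : M →ₗ[R] R, φ a ≠ 0 := by
  let F := FractionRing R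
  let l := LocalizedModule.mkLinearMap R⁰ M
  have hl : l a ≠ 0 := fun h ↦ by
    obtain ⟨c, hc⟩ := (IsLocalizedModule.eq_zero_iff R⁰ l).1 h
    exact (smul_ne_zero (nonZeroDivisors.ne_zero c.2) ha) hc
  obtain ⟨ψ, hψ⟩ := Module.Projective.exists_dual_ne_zero F (V := LocalizedModule R⁰ M) hl
  let f : M →ₗ[R] F := ψ.restrictScalars R ∘ₗ l
  obtain ⟨s, hs⟩ := Module.Finite.fg_top (R := R) (M := M)
  obtain ⟨c, hc⟩ := IsLocalization.exist_integer_multiples R⁰ s f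
  let N := LinearMap.range (Algebra.linearMap R F)
  have hN (m : M) : ((c : R) • f) m ∈ N := by
    have : Submodule.span R (s : Set M) ≤ N.comap ((c : R) • f) :=
      Submodule.span_le.2 fun m hm ↦ hc m hm
    exact this (hs ▸ Submodule.mem_top)
  let e := LinearEquiv.ofInjective (Algebra.linearMap R F) (IsFractionRing.injective R F)
  refine ⟨e.symm ∘ₗ ((c : R) • f).codRestrict N hN, fun h ↦ ?_⟩
  have h' := congrArg Subtype.val (e.symm.map_eq_zero_iff.1 h)
  exact smul_ne_zero (nonZeroDivisors.ne_zero c.2) hψ h'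

theorem LinearMap.apply_mem_of_mem_map_algebraMap {R S : Type*} [CommRing R] [CommRing S]
    [Algebra R S] (φ : S →ₗ[R] R) (m : Ideal R) {a : S} (ha : a ∈ m.map (algebraMap R S)) :
    φ a ∈ m := by
  have h : m • (⊤ : Submodule R S) ≤ Submodule.comap φ m := Submodule.smul_le.2 fun r hr n _ ↦ by
    simpa using m.mul_mem_right (φ n) hr
  rw [Ideal.smul_top_eq_map] at h
  exact h ha

/-- Extending the ideal of a rational point along a finite map gives an ideal of finite
codimension. -/
theorem MvPolynomial.finite_quotient_map_ker_eval {K A σ : Type*} [Field K] [CommRing A]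
    [Algebra K A] (g : MvPolynomial σ K →ₐ[K] A) (hg : g.Finite) (x : σ → K) :
    FiniteDimensional K (A ⧸ (RingHom.ker (MvPolynomial.eval x)).map g.toRingHom) := by
  set L := (RingHom.ker (MvPolynomial.eval x)).map g.toRingHom
  have h : ((algebraMap K (A ⧸ L)).comp (MvPolynomial.eval x)).Finite := by
    have h₁ : ((Ideal.Quotient.mk L).comp g.toRingHom).Finite :=
      (RingHom.Finite.of_surjective _ Ideal.Quotient.mk_surjective).comp hg
    convert h₁ using 1
    refine RingHom.ext fun p ↦ ?_
    have hp : p - MvPolynomial.C (MvPolynomial.eval x p) ∈ RingHom.ker (MvPolynomial.eval x) := by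
      simp [RingHom.mem_ker]
    have h₂ := Ideal.Quotient.eq_zero_iff_mem.2 (Ideal.mem_map_of_mem g.toRingHom hp)
    rw [map_sub, map_sub, sub_eq_zero] at h₂
    refine Eq.trans ?_ h₂.symm
    change _ = Ideal.Quotient.mk L (g (algebraMap K _ _))
    rw [g.commutes]
    rfl
  exact RingHom.finite_algebraMap.1 h.of_comp_finite

/-- The case of an algebra all of whose zero divisors are nilpotent. -/
theorem exists_eq_bot_of_isPrimary_bot {K A : Type*} [Field K] [Uncountable K] [CommRing A]
    [Algebra K A] [Algebra.FiniteType K A] (hA : (⊥ : Ideal A).IsPrimary) (I : ℕ → Ideal A)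
    (hI : ∀ L : Ideal A, FiniteDimensional K (A ⧸ L) → ∃ i, I i ≤ L) : ∃ i, I i = ⊥ := by
  rw [Ideal.isPrimary_iff] at hA
  have : Nontrivial A := ⟨⟨0, 1, fun h ↦ hA.1 ((Ideal.eq_top_iff_one _).2 h.symm)⟩⟩
  obtain ⟨n, g, hinj, hfin⟩ := exists_finite_inj_algHom_of_fg K A
  algebraize [g.toRingHom]
  have : Module.Finite (MvPolynomial (Fin n) K) A := hfin
  have htf : Module.IsTorsionFree (MvPolynomial (Fin n) K) A := by
    rw [Module.isTorsionFree_iff_smul_eq_zero]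
    intro p a h
    refine or_iff_not_imp_right.2 fun ha ↦ ?_
    rw [Algebra.smul_def, mul_comm] at h
    obtain ⟨k, hk⟩ := (hA.2 (Ideal.mem_bot.2 h)).resolve_left ha
    have hk : g p ^ k = 0 := hk
    rw [← map_pow] at hk
    exact eq_zero_of_pow_eq_zero ((map_eq_zero_iff g hinj).1 hk)
  by_contra! hne
  choose a haI ha using fun i ↦ Submodule.exists_mem_ne_zero_of_ne_bot (hne i)
  choose φ hφ using fun i ↦
    Module.exists_dual_apply_ne_zero_of_isTorsionFree (R := MvPolynomial (Fin n) K) (ha i)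
  obtain ⟨x, hx⟩ := MvPolynomial.exists_forall_eval_ne_zero_of_countable n _ hφ
  obtain ⟨i, hi⟩ := hI _ (MvPolynomial.finite_quotient_map_ker_eval g hfin x)
  exact hx i ((φ i).apply_mem_of_mem_map_algebraMap _ (hi (haI i)))

theorem exists_le_of_isPrimary {K A : Type*} [Field K] [Uncountable K] [CommRing A]
    [Algebra K A] [Algebra.FiniteType K A] (I : ℕ → Ideal A)
    (hI : ∀ L : Ideal A, FiniteDimensional K (A ⧸ L) → ∃ i, I i ≤ L)
    {Q : Ideal A} (hQ : Q.IsPrimary) : ∃ i, I i ≤ Q := by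
  have hbot : (⊥ : Ideal (A ⧸ Q)).IsPrimary := by
    rw [Ideal.isPrimary_iff] at hQ ⊢
    have := Ideal.Quotient.nontrivial_iff.2 hQ.1
    refine ⟨bot_ne_top, fun {x y} h ↦ ?_⟩
    obtain ⟨x, rfl⟩ := Ideal.Quotient.mk_surjective x
    obtain ⟨y, rfl⟩ := Ideal.Quotient.mk_surjective y
    rw [← map_mul, Ideal.mem_bot, Ideal.Quotient.eq_zero_iff_mem] at h
    refine (hQ.2 h).imp Ideal.Quotient.eq_zero_iff_mem.2 fun ⟨k, hk⟩ ↦ ⟨k, ?_⟩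
    rw [← map_pow]
    exact Ideal.Quotient.eq_zero_iff_mem.2 hk
  obtain ⟨i, hi⟩ := exists_eq_bot_of_isPrimary_bot (K := K) hbot
    (fun i ↦ (I i).map (Ideal.Quotient.mk Q)) fun L hL ↦ by
      obtain ⟨i, hi⟩ := hI (L.comap (Ideal.Quotient.mkₐ K Q)) <|
        Module.Finite.of_injective
          (Ideal.quotientMapₐ L (Ideal.Quotient.mkₐ K Q) le_rfl).toLinearMap
          Ideal.quotientMap_injective
      exact ⟨i, Ideal.map_le_iff_le_comap.2 hi⟩
  exact ⟨i, by simpa [Ideal.map_eq_bot_iff_le_ker] using hi⟩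

/-- **Amitsur-type lemma (Lemma 4.4).** Let `K` be an uncountable field and `A`
a finitely generated commutative `K`-algebra. Suppose `{Iᵢ : i ∈ ℕ}` is a
countable family of ideals of `A` such that every ideal `L` of `A` of finite
codimension (i.e. with `A/L` finite-dimensional over `K`) contains some `Iᵢ`.
Then some finite intersection `I_{j₁} ∩ ⋯ ∩ I_{j_d}` is the zero ideal. -/
theorem stmt15 {K A : Type*} [Field K] [Uncountable K] [CommRing A] [Algebra K A]
    [Algebra.FiniteType K A] (I : ℕ → Ideal A)
    (hI : ∀ L : Ideal A, FiniteDimensional K (A ⧸ L) → ∃ i, I i ≤ L) :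
    ∃ s : Finset ℕ, s.Nonempty ∧ (⨅ j ∈ s, I j) = ⊥ := by
  have := Algebra.FiniteType.isNoetherianRing K A
  obtain ⟨t, ht, hprim⟩ := Submodule.isLasker A A ⊥
  choose! i hi using fun Q (hQ : Q ∈ t) ↦ exists_le_of_isPrimary I hI (hprim hQ)
  classical
  refine ⟨insert 0 (t.image i), Finset.insert_nonempty _ _, le_bot_iff.1 ?_⟩
  rw [← ht]
  refine Finset.le_inf fun Q hQ ↦ le_trans ?_ (hi Q hQ)
  exact iInf₂_le (i Q) (Finset.mem_insert_of_mem (Finset.mem_image_of_mem i hQ))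
end
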